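/- arXiv:2507.08947 — 3 statements merged into one kernel-verified Lean document; each statement's English description precedes it below -/
import Mathlib

section
/- For every admissible beamformer v and every decoder side information U that is a measurable function of (H, S), the coherent-decoding ergodic rate dominates the use-and-then-forget rate: E[log(1 + SINR_k^coh(v|U))] ≥ log(1 + SINR_k^UatF(v)), where the left-hand expectation is taken in [0, ∞] (both integrands are nonnegative). -/
open MeasureTheory ProbabilityTheory Matrix Finset
open scoped ENNReal ComplexConjugate MeasureTheory

noncomputable section

/-- The canonical uplink massive MIMO model: `K` users, `M` infrastructure antennas,
CSI `S` taking values in `𝓢`, data symbols `x`, noise `z`, channel `H`, powers `p`. -/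
structure UplinkModel (Ω : Type*) [MeasureSpace Ω] (K M : ℕ) (𝓢 : Type*) [MeasurableSpace 𝓢] where
  x : Fin K → Ω → ℂ
  z : Ω → Fin M → ℂ
  H : Ω → Fin M → Fin K → ℂ
  S : Ω → 𝓢
  p : Ω → Fin K → ℝ
  hx_meas : ∀ j, Measurable (x j)
  hz_meas : Measurable z
  hH_meas : Measurable H
  hS_meas : Measurable S
  hx_L2 : ∀ j, MemLp (x j) 2 ℙ
  hz_L2 : ∀ i, MemLp (fun ω => z ω i) 2 ℙ
  hx_mean : ∀ j, ∫ ω, x j ω = 0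
  hx_var : ∀ j, ∫ ω, ‖x j ω‖ ^ 2 = 1
  hz_mean : ∀ i, ∫ ω, z ω i = 0
  hz_cov : ∀ i i', ∫ ω, z ω i * conj (z ω i') = if i = i' then 1 else 0
  hp_nonneg : ∀ ω j, 0 ≤ p ω j
  hp_meas : Measurable[MeasurableSpace.comap S inferInstance] p
  hp_bdd : ∃ C : ℝ, ∀ᵐ ω, ∀ j, p ω j ≤ C
  /-- `(x 0, …, x (K-1))`, `z` and the pair `(H, S)` are mutually independent. -/
  hindep : iIndep (fun i : Fin K ⊕ Bool =>
    Sum.elim (fun j => MeasurableSpace.comap (x j) inferInstance)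
      (fun b => if b then MeasurableSpace.comap (fun ω => (H ω, S ω)) inferInstance
        else MeasurableSpace.comap z inferInstance) i) ℙ
  /-- `E[‖H Hᴴ‖_F²] < ∞`. -/
  hHHherm_L2 : Integrable (fun ω =>
    ∑ i, ∑ i', ‖(Matrix.of (H ω) * (Matrix.of (H ω))ᴴ) i i'‖ ^ 2)

namespace UplinkModel

variable {Ω : Type*} [MeasureSpace Ω] {K M : ℕ} {𝓢 : Type*} [MeasurableSpace 𝓢]

/-- The received uplink signal `r = ∑ j √(p j) • h j * x j + z`. -/
def r (Mo : UplinkModel Ω K M 𝓢) (ω : Ω) : Fin M → ℂ := fun i =>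
  (∑ j, (Real.sqrt (Mo.p ω j) : ℂ) * Mo.H ω i j * Mo.x j ω) + Mo.z ω i

/-- `g j v = √(p j) h jᴴ v`. -/
def g (Mo : UplinkModel Ω K M 𝓢) (j : Fin K) (v : Ω → Fin M → ℂ) (ω : Ω) : ℂ :=
  (Real.sqrt (Mo.p ω j) : ℂ) * ∑ i, conj (Mo.H ω i j) * v ω i

/-- The signal estimate `y k = vᴴ r`. -/
def y (Mo : UplinkModel Ω K M 𝓢) (v : Ω → Fin M → ℂ) (ω : Ω) : ℂ :=
  ∑ i, conj (v ω i) * Mo.r ω i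

/-- `MSE k v = E[|x k − vᴴ r|²]`. -/
def MSE (Mo : UplinkModel Ω K M 𝓢) (k : Fin K) (v : Ω → Fin M → ℂ) : ℝ :=
  ∫ ω, ‖Mo.x k ω - Mo.y v ω‖ ^ 2

/-- The use-and-then-forget SINR (with the convention `0/0 = 0`, which is automatic for
real division in Lean). -/
def SINR_UatF (Mo : UplinkModel Ω K M 𝓢) (k : Fin K) (v : Ω → Fin M → ℂ) : ℝ :=
  ‖∫ ω, Mo.g k v ω‖ ^ 2 /
    (((∫ ω, ‖Mo.g k v ω‖ ^ 2) - ‖∫ ω, Mo.g k v ω‖ ^ 2)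
      + (∑ j ∈ Finset.univ.erase k, ∫ ω, ‖Mo.g j v ω‖ ^ 2)
      + ∫ ω, ∑ i, ‖v ω i‖ ^ 2)

/-- The coherent-decoding conditional SINR given the σ-algebra `m` (generated by the decoder
side information), with the convention `0/0 = 0`. -/
def SINR_coh (Mo : UplinkModel Ω K M 𝓢) (m : MeasurableSpace Ω) (k : Fin K)
    (v : Ω → Fin M → ℂ) (ω : Ω) : ℝ :=
  ‖(ℙ[Mo.g k v | m]) ω‖ ^ 2 /
    (((ℙ[fun ω' => ‖Mo.g k v ω'‖ ^ 2 | m]) ω - ‖(ℙ[Mo.g k v | m]) ω‖ ^ 2)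
      + (∑ j ∈ Finset.univ.erase k, (ℙ[fun ω' => ‖Mo.g j v ω'‖ ^ 2 | m]) ω)
      + (ℙ[fun ω' => ∑ i, ‖v ω' i‖ ^ 2 | m]) ω)

/-- An admissible beamformer: a `σ(S)`-measurable `v` with `E[‖v‖⁴] < ∞`. -/
def Admissible (Mo : UplinkModel Ω K M 𝓢) (v : Ω → Fin M → ℂ) : Prop :=
  Measurable[MeasurableSpace.comap Mo.S inferInstance] v ∧
    Integrable (fun ω => (∑ i, ‖v ω i‖ ^ 2) ^ 2)

end UplinkModel

lemma uatf_pointwise (a A : ℂ) (t T : ℝ) (ht : 0 < t) (hm : 0 < 1 - ‖a‖ ^ 2 / t)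
    (hD : 0 ≤ T - ‖A‖ ^ 2) (hD0 : T - ‖A‖ ^ 2 = 0 → A = 0) :
    -Real.log (1 - ‖a‖ ^ 2 / t) - (1 - 2 * (a.re * A.re + a.im * A.im) / t + ‖a‖ ^ 2 / t ^ 2 * T
      - (1 - ‖a‖ ^ 2 / t)) / (1 - ‖a‖ ^ 2 / t) ≤ Real.log (1 + ‖A‖ ^ 2 / (T - ‖A‖ ^ 2)) := by
  set m := 1 - ‖a‖ ^ 2 / t with hmdef
  set q := 1 - 2 * (a.re * A.re + a.im * A.im) / t + ‖a‖ ^ 2 / t ^ 2 * T with hq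
  have key : ∀ y : ℝ, 0 < y → y ≤ q → -Real.log m - (q - m) / m ≤ -Real.log y := by
    intro y hy hyq
    have h1 := Real.log_le_sub_one_of_pos (div_pos hy hm)
    rw [Real.log_div hy.ne' hm.ne'] at h1
    have h2 : y / m ≤ q / m := by gcongr
    have h3 : (q - m) / m = q / m - 1 := by field_simp
    rw [h3]; linarith
  rcases hD.eq_or_lt with h | h
  · have hA := hD0 h.symm
    have hT : T = 0 := by rw [hA] at h; simp at h; exact h.symm
    rw [← h]
    have := key 1 one_pos (by rw [hq, hA, hT]; simp)
    simpa using this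
  · have hT : 0 < T := by nlinarith [sq_nonneg ‖A‖]
    have h1 : 1 + ‖A‖ ^ 2 / (T - ‖A‖ ^ 2) = (1 - ‖A‖ ^ 2 / T)⁻¹ := by
      have : T - ‖A‖ ^ 2 ≠ 0 := h.ne'
      have h2 : 1 - ‖A‖ ^ 2 / T = (T - ‖A‖ ^ 2) / T := by field_simp
      rw [h2, inv_div]; field_simp; ring
    rw [h1, Real.log_inv]
    apply key
    · rw [sub_pos, div_lt_one hT]; linarith
    · have hh : q - (1 - ‖A‖ ^ 2 / T) =
          ((t * A.re - T * a.re) ^ 2 + (t * A.im - T * a.im) ^ 2) / (T * t ^ 2) := by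
        rw [hq, ← Complex.normSq_eq_norm_sq, ← Complex.normSq_eq_norm_sq, Complex.normSq_apply,
          Complex.normSq_apply]
        field_simp
        ring
      have : 0 ≤ q - (1 - ‖A‖ ^ 2 / T) := by rw [hh]; positivity
      linarith

lemma ofReal_integral_le_lintegral_aux {Ω : Type*} [MeasurableSpace Ω] (μ : Measure Ω)
    (f : Ω → ℝ) (hf : Integrable f μ) :
    ENNReal.ofReal (∫ ω, f ω ∂μ) ≤ ∫⁻ ω, ENNReal.ofReal (f ω) ∂μ := by
  have h1 : ∫ ω, f ω ∂μ ≤ ∫ ω, max (f ω) 0 ∂μ :=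
    integral_mono hf hf.pos_part (fun ω => le_max_left _ _)
  refine (ENNReal.ofReal_le_ofReal h1).trans ?_
  rw [ofReal_integral_eq_lintegral_ofReal hf.pos_part (ae_of_all _ fun ω => le_max_right _ _)]
  apply lintegral_mono
  intro ω
  simp

lemma uatf_core {Ω : Type*} {m0 : MeasurableSpace Ω} (μ : Measure Ω) [IsProbabilityMeasure μ]
    (A : Ω → ℂ) (T : Ω → ℝ) (hA : Integrable A μ) (hT : Integrable T μ)
    (hle : ‖∫ ω, A ω ∂μ‖ ^ 2 ≤ ∫ ω, T ω ∂μ)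
    (hD : ∀ᵐ ω ∂μ, 0 ≤ T ω - ‖A ω‖ ^ 2)
    (hD0 : ∀ᵐ ω ∂μ, T ω - ‖A ω‖ ^ 2 = 0 → A ω = 0) :
    ENNReal.ofReal (Real.log (1 + ‖∫ ω, A ω ∂μ‖ ^ 2 / (∫ ω, T ω ∂μ - ‖∫ ω, A ω ∂μ‖ ^ 2))) ≤
      ∫⁻ ω, ENNReal.ofReal (Real.log (1 + ‖A ω‖ ^ 2 / (T ω - ‖A ω‖ ^ 2))) ∂μ := by
  set a := ∫ ω, A ω ∂μ with ha
  set t := ∫ ω, T ω ∂μ with ht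
  rcases hle.eq_or_lt with h | h
  · simp [h]
  have htpos : 0 < t := lt_of_le_of_lt (sq_nonneg _) h
  have hm : 0 < 1 - ‖a‖ ^ 2 / t := by rw [sub_pos, div_lt_one htpos]; exact h
  set L : Ω → ℝ := fun ω => -Real.log (1 - ‖a‖ ^ 2 / t) -
    (1 - 2 * (a.re * (A ω).re + a.im * (A ω).im) / t + ‖a‖ ^ 2 / t ^ 2 * T ω
      - (1 - ‖a‖ ^ 2 / t)) / (1 - ‖a‖ ^ 2 / t) with hL
  have hre : Integrable (fun ω => (A ω).re) μ := hA.re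
  have him : Integrable (fun ω => (A ω).im) μ := hA.im
  have hre' : ∫ ω, (A ω).re ∂μ = a.re := integral_re hA
  have him' : ∫ ω, (A ω).im ∂μ = a.im := integral_im hA
  have i1 : Integrable (fun ω => 2 * (a.re * (A ω).re + a.im * (A ω).im) / t) μ :=
    ((((hre.const_mul _).add (him.const_mul _)).const_mul 2).div_const t)
  have i2 : Integrable (fun ω => ‖a‖ ^ 2 / t ^ 2 * T ω) μ := hT.const_mul _
  have i3 : Integrable (fun ω => 1 - 2 * (a.re * (A ω).re + a.im * (A ω).im) / t) μ :=
    (integrable_const _).sub i1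
  have i4 : Integrable (fun ω => 1 - 2 * (a.re * (A ω).re + a.im * (A ω).im) / t
      + ‖a‖ ^ 2 / t ^ 2 * T ω) μ := i3.add i2
  have i5 : Integrable (fun ω => (1 - 2 * (a.re * (A ω).re + a.im * (A ω).im) / t
      + ‖a‖ ^ 2 / t ^ 2 * T ω - (1 - ‖a‖ ^ 2 / t)) / (1 - ‖a‖ ^ 2 / t)) μ :=
    (i4.sub (integrable_const _)).div_const _
  have iL : Integrable L μ := (integrable_const _).sub i5
  have hint : ∫ ω, L ω ∂μ = -Real.log (1 - ‖a‖ ^ 2 / t) := by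
    rw [hL, integral_sub (integrable_const _) i5, integral_div,
      integral_sub i4 (integrable_const _), integral_add i3 i2, integral_sub (integrable_const _) i1,
      integral_div, integral_const_mul, integral_add (hre.const_mul _) (him.const_mul _),
      integral_const_mul, integral_const_mul, integral_const_mul, hre', him', ← ht]
    simp only [integral_const, probReal_univ, one_smul]
    have : 2 * (a.re * a.re + a.im * a.im) = 2 * ‖a‖ ^ 2 := by
      rw [← Complex.normSq_eq_norm_sq, Complex.normSq_apply]
    rw [this]
    have h0 : (1 - 2 * ‖a‖ ^ 2 / t + ‖a‖ ^ 2 / t ^ 2 * t - (1 - ‖a‖ ^ 2 / t)) = 0 := by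
      field_simp; ring
    rw [h0]; simp
  have h1 : Real.log (1 + ‖a‖ ^ 2 / (t - ‖a‖ ^ 2)) = ∫ ω, L ω ∂μ := by
    rw [hint, ← Real.log_inv]
    congr 1
    have h2 : 1 - ‖a‖ ^ 2 / t = (t - ‖a‖ ^ 2) / t := by field_simp
    have : t - ‖a‖ ^ 2 ≠ 0 := by linarith
    rw [h2, inv_div]; field_simp; ring
  rw [h1]
  refine (ofReal_integral_le_lintegral_aux μ L iL).trans (lintegral_mono_ae ?_)
  filter_upwards [hD, hD0] with ω h1 h2
  exact ENNReal.ofReal_le_ofReal (uatf_pointwise a (A ω) t (T ω) htpos hm h1 h2)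

lemma sq_norm_condExp_le_aux {Ω : Type*} {m m0 : MeasurableSpace Ω} (μ : Measure Ω)
    (f : Ω → ℂ) (hf : Integrable (fun ω => ‖f ω‖ ^ 2) μ) :
    ∀ᵐ ω ∂μ, ‖(μ[f | m]) ω‖ ^ 2 ≤ (μ[fun ω => ‖f ω‖ ^ 2 | m]) ω := by
  have := Integrable.norm_condExp_rpow_le (m := m) (μ := μ) (f := f) (p := 2) (by norm_num)
    (by simpa using hf)
  simp only [Real.rpow_two] at this
  exact this

/-- If the conditional expectation of a nonnegative `V` vanishes, so does that of any
nonnegative `W` vanishing wherever `V` does. -/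
lemma condExp_zero_transfer {Ω : Type*} {m m0 : MeasurableSpace Ω} (hm : m ≤ m0) (μ : Measure Ω)
    [IsProbabilityMeasure μ] (V W : Ω → ℝ) (hV : Integrable V μ) (hW : Integrable W μ)
    (hV0 : ∀ ω, 0 ≤ V ω) (hW0 : ∀ ω, 0 ≤ W ω) (hVW : ∀ ω, V ω = 0 → W ω = 0) :
    ∀ᵐ ω ∂μ, (μ[V | m]) ω = 0 → (μ[W | m]) ω = 0 := by
  set s : Set Ω := {ω | (μ[V | m]) ω = 0} with hs
  have hsm : MeasurableSet[m] s :=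
    (stronglyMeasurable_condExp (μ := μ) (m := m) (f := V)).measurable (measurableSet_singleton 0)
  have hsm0 : MeasurableSet s := hm s hsm
  have h1 : ∫ ω in s, V ω ∂μ = 0 := by
    rw [← setIntegral_condExp hm hV hsm]
    exact setIntegral_eq_zero_of_forall_eq_zero fun ω hω => hω
  have h2 : V =ᵐ[μ.restrict s] 0 :=
    (setIntegral_eq_zero_iff_of_nonneg_ae (ae_of_all _ hV0) hV.integrableOn).1 h1
  have h3 : ∫ ω in s, W ω ∂μ = 0 := by
    apply integral_eq_zero_of_ae
    filter_upwards [h2] with ω hω using hVW ω hω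
  rw [← setIntegral_condExp hm hW hsm] at h3
  have h4 := (setIntegral_eq_zero_iff_of_nonneg_ae (ae_restrict_of_ae
    (condExp_nonneg (ae_of_all _ hW0))) integrable_condExp.integrableOn).1 h3
  exact (ae_restrict_iff' hsm0).1 h4

namespace UplinkModel

variable {Ω : Type*} [MeasureSpace Ω] {K M : ℕ} {𝓢 : Type*} [MeasurableSpace 𝓢]

lemma Admissible.measurable {Mo : UplinkModel Ω K M 𝓢} {v : Ω → Fin M → ℂ}
    (hv : Mo.Admissible v) : Measurable v :=
  hv.1.mono Mo.hS_meas.comap_le le_rfl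

lemma measurable_g (Mo : UplinkModel Ω K M 𝓢) {v : Ω → Fin M → ℂ}
    (hv : Mo.Admissible v) (j : Fin K) : Measurable (Mo.g j v) := by
  have h1 := hv.measurable
  have h2 : Measurable Mo.p := Mo.hp_meas.mono Mo.hS_meas.comap_le le_rfl
  have h3 := Mo.hH_meas
  have h4 : ∀ i, Measurable fun ω => conj (Mo.H ω i j) := fun i =>
    Complex.continuous_conj.measurable.comp
      ((measurable_pi_apply j).comp ((measurable_pi_apply i).comp h3))
  have h5 : ∀ i, Measurable fun ω => v ω i := fun i => (measurable_pi_apply i).comp h1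
  have h6 : Measurable fun ω => (Real.sqrt (Mo.p ω j) : ℂ) :=
    Complex.measurable_ofReal.comp (((measurable_pi_apply j).comp h2).sqrt)
  exact h6.mul (Finset.measurable_fun_sum _ fun i _ => (h4 i).mul (h5 i))

lemma integrable_V [IsProbabilityMeasure (ℙ : Measure Ω)] (Mo : UplinkModel Ω K M 𝓢)
    {v : Ω → Fin M → ℂ} (hv : Mo.Admissible v) : Integrable (fun ω => ∑ i, ‖v ω i‖ ^ 2) := by
  have h5 : ∀ i, Measurable fun ω => v ω i := fun i => (measurable_pi_apply i).comp hv.measurable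
  refine Integrable.mono' ((integrable_const (1 : ℝ)).add hv.2)
    (Finset.measurable_fun_sum _ fun i _ => ((h5 i).norm.pow_const 2)).aestronglyMeasurable
    (ae_of_all _ fun ω => ?_)
  have : 0 ≤ ∑ i, ‖v ω i‖ ^ 2 := by positivity
  rw [Real.norm_of_nonneg this]
  simp only [Pi.add_apply]
  nlinarith

lemma norm_H_pow_le (Mo : UplinkModel Ω K M 𝓢) (ω : Ω) (i : Fin M) (j : Fin K) :
    (‖Mo.H ω i j‖ ^ 2) ^ 2 ≤
      ∑ i, ∑ i', ‖(Matrix.of (Mo.H ω) * (Matrix.of (Mo.H ω))ᴴ) i i'‖ ^ 2 := by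
  have h1 : (Matrix.of (Mo.H ω) * (Matrix.of (Mo.H ω))ᴴ) i i =
      ((∑ l, ‖Mo.H ω i l‖ ^ 2 : ℝ) : ℂ) := by
    simp [Matrix.mul_apply, Complex.mul_conj, Complex.normSq_eq_norm_sq]
  have h2 : ‖Mo.H ω i j‖ ^ 2 ≤ ∑ l, ‖Mo.H ω i l‖ ^ 2 :=
    Finset.single_le_sum (f := fun l => ‖Mo.H ω i l‖ ^ 2) (fun _ _ => by positivity)
      (Finset.mem_univ j)
  have h3 : ‖Mo.H ω i j‖ ^ 2 ≤ ‖(Matrix.of (Mo.H ω) * (Matrix.of (Mo.H ω))ᴴ) i i‖ := by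
    rw [h1, Complex.norm_real]; exact h2.trans (le_abs_self _)
  calc (‖Mo.H ω i j‖ ^ 2) ^ 2
      ≤ ‖(Matrix.of (Mo.H ω) * (Matrix.of (Mo.H ω))ᴴ) i i‖ ^ 2 := by gcongr
    _ ≤ ∑ i', ‖(Matrix.of (Mo.H ω) * (Matrix.of (Mo.H ω))ᴴ) i i'‖ ^ 2 :=
        Finset.single_le_sum
          (f := fun i' => ‖(Matrix.of (Mo.H ω) * (Matrix.of (Mo.H ω))ᴴ) i i'‖ ^ 2)
          (fun _ _ => by positivity) (Finset.mem_univ i)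
    _ ≤ _ := Finset.single_le_sum
          (f := fun i => ∑ i', ‖(Matrix.of (Mo.H ω) * (Matrix.of (Mo.H ω))ᴴ) i i'‖ ^ 2)
          (fun _ _ => by positivity) (Finset.mem_univ i)

lemma norm_g_sq_le (Mo : UplinkModel Ω K M 𝓢) (v : Ω → Fin M → ℂ) (j : Fin K) (ω : Ω) :
    ‖Mo.g j v ω‖ ^ 2 ≤ Mo.p ω j * (M * (M *
      (∑ i, ∑ i', ‖(Matrix.of (Mo.H ω) * (Matrix.of (Mo.H ω))ᴴ) i i'‖ ^ 2) +
        M * (∑ i, ‖v ω i‖ ^ 2) ^ 2)) := by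
  set F := ∑ i, ∑ i', ‖(Matrix.of (Mo.H ω) * (Matrix.of (Mo.H ω))ᴴ) i i'‖ ^ 2 with hF
  set V := ∑ i, ‖v ω i‖ ^ 2 with hV
  have h0 : ‖Mo.g j v ω‖ ^ 2 = Mo.p ω j * ‖∑ i, conj (Mo.H ω i j) * v ω i‖ ^ 2 := by
    rw [g, norm_mul, mul_pow, Complex.norm_real, Real.norm_of_nonneg (Real.sqrt_nonneg _),
      Real.sq_sqrt (Mo.hp_nonneg ω j)]
  rw [h0]
  refine mul_le_mul_of_nonneg_left ?_ (Mo.hp_nonneg ω j)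
  have h1 : ‖∑ i, conj (Mo.H ω i j) * v ω i‖ ≤ ∑ i, ‖Mo.H ω i j‖ * ‖v ω i‖ := by
    refine (norm_sum_le _ _).trans (le_of_eq ?_)
    simp
  have h2 : (∑ i, ‖Mo.H ω i j‖ * ‖v ω i‖) ^ 2 ≤ M * ∑ i, (‖Mo.H ω i j‖ * ‖v ω i‖) ^ 2 := by
    have := sq_sum_le_card_mul_sum_sq (s := (Finset.univ : Finset (Fin M)))
      (f := fun i => ‖Mo.H ω i j‖ * ‖v ω i‖)
    simpa using this
  have h3 : ∑ i, (‖Mo.H ω i j‖ * ‖v ω i‖) ^ 2 ≤ ∑ _i : Fin M, (F + V ^ 2) := by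
    refine Finset.sum_le_sum fun i _ => ?_
    have e1 := Mo.norm_H_pow_le ω i j
    have e2 : ‖v ω i‖ ^ 2 ≤ V := Finset.single_le_sum (f := fun i => ‖v ω i‖ ^ 2)
      (fun _ _ => by positivity) (Finset.mem_univ i)
    have e3 : (‖v ω i‖ ^ 2) ^ 2 ≤ V ^ 2 := by gcongr
    rw [mul_pow]
    nlinarith [sq_nonneg (‖Mo.H ω i j‖ ^ 2 - ‖v ω i‖ ^ 2), sq_nonneg (‖Mo.H ω i j‖ ^ 2),
      sq_nonneg (‖v ω i‖ ^ 2)]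
  have h4 : ∑ _i : Fin M, (F + V ^ 2) = M * F + M * V ^ 2 := by
    simp [mul_add]
  calc ‖∑ i, conj (Mo.H ω i j) * v ω i‖ ^ 2
      ≤ (∑ i, ‖Mo.H ω i j‖ * ‖v ω i‖) ^ 2 := by gcongr
    _ ≤ M * ∑ i, (‖Mo.H ω i j‖ * ‖v ω i‖) ^ 2 := h2
    _ ≤ M * (M * F + M * V ^ 2) := by rw [← h4]; gcongr

lemma integrable_norm_g_sq [IsProbabilityMeasure (ℙ : Measure Ω)] (Mo : UplinkModel Ω K M 𝓢)
    {v : Ω → Fin M → ℂ} (hv : Mo.Admissible v) (j : Fin K) :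
    Integrable (fun ω => ‖Mo.g j v ω‖ ^ 2) := by
  obtain ⟨C, hC⟩ := Mo.hp_bdd
  refine Integrable.mono' ((((Mo.hHHherm_L2.const_mul (M : ℝ)).add
    (hv.2.const_mul (M : ℝ))).const_mul (M : ℝ)).const_mul C)
    ((Mo.measurable_g hv j).norm.pow_const 2).aestronglyMeasurable ?_
  filter_upwards [hC] with ω hω
  rw [Real.norm_of_nonneg (by positivity)]
  refine (Mo.norm_g_sq_le v j ω).trans ?_
  exact mul_le_mul_of_nonneg_right (hω j) (by positivity)

lemma integrable_g [IsProbabilityMeasure (ℙ : Measure Ω)] (Mo : UplinkModel Ω K M 𝓢)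
    {v : Ω → Fin M → ℂ} (hv : Mo.Admissible v) (j : Fin K) :
    Integrable (Mo.g j v) := by
  refine Integrable.mono' ((integrable_const (1 : ℝ)).add (Mo.integrable_norm_g_sq hv j))
    (Mo.measurable_g hv j).aestronglyMeasurable (ae_of_all _ fun ω => ?_)
  simp only [Pi.add_apply]
  nlinarith [sq_nonneg (‖Mo.g j v ω‖ - 1), norm_nonneg (Mo.g j v ω)]

lemma g_eq_zero (Mo : UplinkModel Ω K M 𝓢) (v : Ω → Fin M → ℂ) (j : Fin K) (ω : Ω)
    (h : ∑ i, ‖v ω i‖ ^ 2 = 0) : ‖Mo.g j v ω‖ ^ 2 = 0 := by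
  have h1 : ∀ i, v ω i = 0 := by
    intro i
    have := (Finset.sum_eq_zero_iff_of_nonneg (fun _ _ => by positivity)).1 h i (Finset.mem_univ i)
    simpa using this
  simp [g, h1]

end UplinkModel

/-- For every admissible beamformer `v` and every decoder side information `U`
that is a measurable function of `(H, S)`, the coherent-decoding ergodic rate dominates the
use-and-then-forget rate:
`E[log(1 + SINR_k^coh(v|U))] ≥ log(1 + SINR_k^UatF(v))`,
where the left-hand expectation is taken in `[0, ∞]`. -/
theorem coherent_rate_ge_uatf_rate
    {Ω : Type*} [MeasureSpace Ω] [IsProbabilityMeasure (ℙ : Measure Ω)]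
    {K M : ℕ} {𝓢 𝓤 : Type*} [MeasurableSpace 𝓢] [MeasurableSpace 𝓤]
    (Mo : UplinkModel Ω K M 𝓢) (k : Fin K)
    (v : Ω → Fin M → ℂ) (hv : Mo.Admissible v)
    (U : Ω → 𝓤) (hU : Measurable U)
    (hUHS : MeasurableSpace.comap U inferInstance ≤
      MeasurableSpace.comap (fun ω => (Mo.H ω, Mo.S ω)) inferInstance) :
    ENNReal.ofReal (Real.log (1 + Mo.SINR_UatF k v)) ≤
      ∫⁻ ω, ENNReal.ofReal
        (Real.log (1 + Mo.SINR_coh (MeasurableSpace.comap U inferInstance) k v ω)) := by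
  have hm : MeasurableSpace.comap U inferInstance ≤ (inferInstance : MeasurableSpace Ω) :=
    hU.comap_le
  set m : MeasurableSpace Ω := MeasurableSpace.comap U inferInstance with hmdef
  have hg := Mo.integrable_norm_g_sq hv
  have hVi := Mo.integrable_V hv
  set T : Ω → ℝ := fun ω => (ℙ[fun ω' => ‖Mo.g k v ω'‖ ^ 2 | m]) ω
      + (∑ j ∈ Finset.univ.erase k, (ℙ[fun ω' => ‖Mo.g j v ω'‖ ^ 2 | m]) ω)
      + (ℙ[fun ω' => ∑ i, ‖v ω' i‖ ^ 2 | m]) ω with hT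
  have is : Integrable (fun ω => ∑ j ∈ Finset.univ.erase k,
      (ℙ[fun ω' => ‖Mo.g j v ω'‖ ^ 2 | m]) ω) :=
    integrable_finsetSum _ fun j _ => integrable_condExp
  have i1 : Integrable (fun ω => (ℙ[fun ω' => ‖Mo.g k v ω'‖ ^ 2 | m]) ω
      + (∑ j ∈ Finset.univ.erase k, (ℙ[fun ω' => ‖Mo.g j v ω'‖ ^ 2 | m]) ω)) :=
    integrable_condExp.add is
  have hTi : Integrable T := i1.add integrable_condExp
  have hTint : ∫ ω, T ω = (∫ ω, ‖Mo.g k v ω‖ ^ 2)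
      + (∑ j ∈ Finset.univ.erase k, ∫ ω, ‖Mo.g j v ω‖ ^ 2) + ∫ ω, ∑ i, ‖v ω i‖ ^ 2 := by
    rw [hT, integral_add i1 integrable_condExp, integral_add integrable_condExp is,
      integral_finsetSum _ (fun j _ => integrable_condExp), integral_condExp hm,
      integral_condExp hm]
    simp only [integral_condExp hm]
  have hAint : ∫ ω, (ℙ[Mo.g k v | m]) ω = ∫ ω, Mo.g k v ω := integral_condExp hm
  have hJ := sq_norm_condExp_le_aux (m := m) ℙ (Mo.g k v) (hg k)
  have hN : ∀ᵐ ω, 0 ≤ (ℙ[fun ω' => ∑ i, ‖v ω' i‖ ^ 2 | m]) ω :=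
    condExp_nonneg (ae_of_all _ fun ω => by simp only [Pi.zero_apply]; positivity)
  have hC : ∀ᵐ ω, ∀ j, 0 ≤ (ℙ[fun ω' => ‖Mo.g j v ω'‖ ^ 2 | m]) ω :=
    ae_all_iff.2 fun j =>
      condExp_nonneg (ae_of_all _ fun ω => by simp only [Pi.zero_apply]; positivity)
  have hZ := condExp_zero_transfer hm ℙ (fun ω' => ∑ i, ‖v ω' i‖ ^ 2)
    (fun ω' => ‖Mo.g k v ω'‖ ^ 2) hVi (hg k) (fun ω => by positivity) (fun ω => by positivity)
    (fun ω h => Mo.g_eq_zero v k ω h)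
  have hJ0 : ‖∫ ω, Mo.g k v ω‖ ^ 2 ≤ ∫ ω, ‖Mo.g k v ω‖ ^ 2 := by
    have h := sq_norm_condExp_le_aux (m := ⊥) ℙ (Mo.g k v) (hg k)
    rw [condExp_bot, condExp_bot] at h
    obtain ⟨ω, hω⟩ := h.exists
    exact hω
  have := uatf_core ℙ (ℙ[Mo.g k v | m]) T integrable_condExp hTi ?_ ?_ ?_
  · rw [hAint, hTint] at this
    convert this using 5
    · rw [UplinkModel.SINR_UatF]; congr 1; ring
    · rw [UplinkModel.SINR_coh]; congr 1; simp only [hT]; ring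
  · rw [hAint, hTint]
    have : 0 ≤ ∑ j ∈ Finset.univ.erase k, ∫ ω, ‖Mo.g j v ω‖ ^ 2 :=
      Finset.sum_nonneg fun j _ => integral_nonneg fun ω => by positivity
    have : 0 ≤ ∫ ω, ∑ i, ‖v ω i‖ ^ 2 := integral_nonneg fun ω => by positivity
    linarith
  · filter_upwards [hJ, hN, hC] with ω h1 h2 h3
    have : 0 ≤ ∑ j ∈ Finset.univ.erase k, (ℙ[fun ω' => ‖Mo.g j v ω'‖ ^ 2 | m]) ω :=
      Finset.sum_nonneg fun j _ => h3 j
    simp only [hT]; linarith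
  · filter_upwards [hJ, hN, hC, hZ] with ω h1 h2 h3 h4 h5
    have h6 : 0 ≤ ∑ j ∈ Finset.univ.erase k, (ℙ[fun ω' => ‖Mo.g j v ω'‖ ^ 2 | m]) ω :=
      Finset.sum_nonneg fun j _ => h3 j
    simp only [hT] at h5
    rw [h4 (by linarith)] at h1
    have h7 : ‖(ℙ[Mo.g k v | m]) ω‖ ^ 2 = 0 := le_antisymm h1 (by positivity)
    simpa using h7
end
end

section
/- Let 𝒱 be a nonempty set of admissible beamformers that is closed under multiplication by complex scalars (α v ∈ 𝒱 for all v ∈ 𝒱, α ∈ ℂ). Then, as an identity in [0, ∞], 1 + sup_{v ∈ 𝒱} SINR_k^UatF(v) = ( inf_{v ∈ 𝒱} MSE_k(v) )⁻¹. Furthermore, if v★ ∈ 𝒱 attains inf_{v ∈ 𝒱} MSE_k(v), then v★ attains sup_{v ∈ 𝒱} SINR_k^UatF(v). -/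
open MeasureTheory ProbabilityTheory Matrix Finset
open scoped ENNReal ComplexConjugate MeasureTheory

noncomputable section

/-- Independence of measurable functions from independence of σ-algebras. -/
theorem indepFun_of_indep_meas {Ω : Type*} {m₁ m₂ : MeasurableSpace Ω} {mΩ : MeasurableSpace Ω}
    {μ : Measure Ω} (h : Indep m₁ m₂ μ) {f g : Ω → ℂ}
    (hf : Measurable[m₁] f) (hg : Measurable[m₂] g) : IndepFun f g μ := by
  rw [IndepFun_iff_Indep]
  exact indep_of_indep_of_le_left (indep_of_indep_of_le_right h hg.comap_le) hf.comap_le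

/-- Second moment of a random combination of uncorrelated, normalized variables whose
coefficients are independent of them. -/
theorem integral_sq_norm_combination {Ω : Type*} {m₁ m₂ : MeasurableSpace Ω} {mΩ : MeasurableSpace Ω}
    {μ : Measure Ω} (h : Indep m₁ m₂ μ)
    {ι : Type*} [Fintype ι] [DecidableEq ι] (c n : ι → Ω → ℂ)
    (hc : ∀ i, Measurable[m₁] (c i)) (hn : ∀ i, Measurable[m₂] (n i))
    (hc2 : ∀ i, MemLp (c i) 2 μ) (hn2 : ∀ i, MemLp (n i) 2 μ)
    (hcov : ∀ i j, ∫ ω, n i ω * conj (n j ω) ∂μ = if i = j then 1 else 0) :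
    ∫ ω, ‖∑ i, c i ω * n i ω‖ ^ 2 ∂μ = ∑ i, ∫ ω, ‖c i ω‖ ^ 2 ∂μ := by
  have hconj : Measurable (fun z : ℂ => conj z) := Complex.continuous_conj.measurable
  have hcc : ∀ i j, Integrable (fun ω => c i ω * conj (c j ω)) μ := fun i j =>
    (hc2 i).integrable_mul (hc2 j).star
  have hnn : ∀ i j, Integrable (fun ω => n i ω * conj (n j ω)) μ := fun i j =>
    (hn2 i).integrable_mul (hn2 j).star
  have hI : ∀ i j, IndepFun (fun ω => c i ω * conj (c j ω)) (fun ω => n i ω * conj (n j ω)) μ :=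
    fun i j => indepFun_of_indep_meas h
      ((hc i).mul (hconj.comp (hc j))) ((hn i).mul (hconj.comp (hn j)))
  have hint : ∀ i j, Integrable
      (fun ω => (c i ω * conj (c j ω)) * (n i ω * conj (n j ω))) μ := fun i j =>
    (hI i j).integrable_mul (hcc i j) (hnn i j)
  have hval : ∀ i j, ∫ ω, (c i ω * conj (c j ω)) * (n i ω * conj (n j ω)) ∂μ
      = if i = j then ∫ ω, c i ω * conj (c j ω) ∂μ else 0 := by
    intro i j
    rw [(hI i j).integral_fun_mul_eq_mul_integral (hcc i j).1 (hnn i j).1, hcov]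
    split_ifs <;> simp
  have hsq : ∀ z : ℂ, ((‖z‖ ^ 2 : ℝ) : ℂ) = z * conj z := by
    intro z; rw [Complex.mul_conj, Complex.normSq_eq_norm_sq]
  apply Complex.ofReal_injective
  rw [← integral_complex_ofReal, Complex.ofReal_sum]
  have e : ∀ ω, ((‖∑ i, c i ω * n i ω‖ ^ 2 : ℝ) : ℂ)
      = ∑ i, ∑ j, (c i ω * conj (c j ω)) * (n i ω * conj (n j ω)) := by
    intro ω
    rw [hsq, map_sum, Finset.sum_mul_sum]
    refine Finset.sum_congr rfl fun i _ => Finset.sum_congr rfl fun j _ => ?_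
    rw [map_mul]; ring
  simp_rw [e]
  rw [integral_finsetSum _ fun i _ => integrable_finsetSum _ fun j _ => hint i j]
  refine Finset.sum_congr rfl fun i _ => ?_
  rw [integral_finsetSum _ fun j _ => hint i j]
  simp_rw [hval]
  rw [Finset.sum_ite_eq, if_pos (Finset.mem_univ _), ← integral_complex_ofReal]
  simp_rw [hsq]

namespace UplinkModel

variable {Ω : Type*} [MeasureSpace Ω] [IsProbabilityMeasure (ℙ : Measure Ω)]
  {K M : ℕ} {𝓢 : Type*} [MeasurableSpace 𝓢]

/-- σ-algebra generated by `(H, S)`. -/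
def mHS (Mo : UplinkModel Ω K M 𝓢) : MeasurableSpace Ω :=
  MeasurableSpace.comap (fun ω => (Mo.H ω, Mo.S ω)) inferInstance

/-- σ-algebra generated by the symbols and the noise. -/
def mXZ (Mo : UplinkModel Ω K M 𝓢) : MeasurableSpace Ω :=
  (⨆ j, MeasurableSpace.comap (Mo.x j) inferInstance) ⊔ MeasurableSpace.comap Mo.z inferInstance

theorem mHS_le (Mo : UplinkModel Ω K M 𝓢) : Mo.mHS ≤ (inferInstance : MeasurableSpace Ω) :=
  (Mo.hH_meas.prodMk Mo.hS_meas).comap_le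

theorem comapS_le (Mo : UplinkModel Ω K M 𝓢) :
    MeasurableSpace.comap Mo.S inferInstance ≤ Mo.mHS := by
  have : Measurable[Mo.mHS] (fun ω => (Mo.H ω, Mo.S ω)) := comap_measurable _
  exact (measurable_snd.comp this).comap_le

theorem H_meas (Mo : UplinkModel Ω K M 𝓢) : Measurable[Mo.mHS] Mo.H := by
  have : Measurable[Mo.mHS] (fun ω => (Mo.H ω, Mo.S ω)) := comap_measurable _
  exact measurable_fst.comp this

theorem indep_mHS_mXZ (Mo : UplinkModel Ω K M 𝓢) : Indep Mo.mHS Mo.mXZ ℙ := by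
  have hle : ∀ i : Fin K ⊕ Bool, Sum.elim (fun j => MeasurableSpace.comap (Mo.x j) inferInstance)
      (fun b => if b then MeasurableSpace.comap (fun ω => (Mo.H ω, Mo.S ω)) inferInstance
        else MeasurableSpace.comap Mo.z inferInstance) i ≤ (inferInstance : MeasurableSpace Ω) := by
    rintro (j | b)
    · exact (Mo.hx_meas j).comap_le
    · cases b
      · exact Mo.hz_meas.comap_le
      · exact Mo.mHS_le
  have h := indep_iSup_of_disjoint hle Mo.hindep
    (S := {Sum.inr true}) (T := {Sum.inr true}ᶜ) disjoint_compl_right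
  refine indep_of_indep_of_le_left (indep_of_indep_of_le_right h ?_) ?_
  · refine sup_le (iSup_le fun j => ?_) ?_
    · exact le_iSup₂_of_le (Sum.inl j) (by simp) le_rfl
    · exact le_iSup₂_of_le (Sum.inr false) (by simp) le_rfl
  · exact le_iSup₂_of_le (Sum.inr true) (by simp) le_rfl

theorem indep_x_x (Mo : UplinkModel Ω K M 𝓢) {i j : Fin K} (h : i ≠ j) :
    Indep (MeasurableSpace.comap (Mo.x i) inferInstance)
      (MeasurableSpace.comap (Mo.x j) inferInstance) ℙ := by
  exact Mo.hindep.indep (i := Sum.inl i) (j := Sum.inl j) (by simpa using h)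

theorem indep_x_z (Mo : UplinkModel Ω K M 𝓢) (i : Fin K) :
    Indep (MeasurableSpace.comap (Mo.x i) inferInstance)
      (MeasurableSpace.comap Mo.z inferInstance) ℙ := by
  exact Mo.hindep.indep (i := Sum.inl i) (j := Sum.inr false) (by simp)

theorem v_meas (Mo : UplinkModel Ω K M 𝓢) {v : Ω → Fin M → ℂ} (hv : Mo.Admissible v) :
    Measurable[Mo.mHS] v := hv.1.mono Mo.comapS_le le_rfl

theorem g_meas (Mo : UplinkModel Ω K M 𝓢) {v : Ω → Fin M → ℂ} (hv : Mo.Admissible v)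
    (j : Fin K) : Measurable[Mo.mHS] (Mo.g j v) := by
  have hp : Measurable[Mo.mHS] Mo.p := Mo.hp_meas.mono Mo.comapS_le le_rfl
  have hV := Mo.v_meas hv
  have hH := Mo.H_meas
  have hconj : Measurable (fun z : ℂ => conj z) := Complex.continuous_conj.measurable
  unfold g
  refine Measurable.mul ?_ ?_
  · exact Complex.measurable_ofReal.comp
      (Real.continuous_sqrt.measurable.comp ((measurable_pi_apply j).comp hp))
  · refine Finset.measurable_fun_sum _ fun i _ => Measurable.mul ?_ ?_
    · exact hconj.comp ((measurable_pi_apply j).comp ((measurable_pi_apply i).comp hH))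
    · exact (measurable_pi_apply i).comp hV

theorem v_memLp (Mo : UplinkModel Ω K M 𝓢) {v : Ω → Fin M → ℂ} (hv : Mo.Admissible v)
    (i : Fin M) : MemLp (fun ω => v ω i) 2 ℙ := by
  have hm : Measurable v := (Mo.v_meas hv).mono Mo.mHS_le le_rfl
  have hmi : Measurable fun ω => v ω i := (measurable_pi_apply i).comp hm
  rw [memLp_two_iff_integrable_sq_norm hmi.aestronglyMeasurable]
  refine Integrable.mono' (hv.2.add (integrable_const (1 : ℝ)))
    (hmi.norm.pow_const 2).aestronglyMeasurable (Filter.Eventually.of_forall fun ω => ?_)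
  have h1 : ‖v ω i‖ ^ 2 ≤ ∑ i, ‖v ω i‖ ^ 2 :=
    Finset.single_le_sum (f := fun i => ‖v ω i‖ ^ 2) (fun _ _ => by positivity)
      (Finset.mem_univ i)
  rw [Real.norm_of_nonneg (by positivity)]
  simp only [Pi.add_apply]
  nlinarith [sq_nonneg ((∑ i, ‖v ω i‖ ^ 2) - 1), sq_nonneg (∑ i, ‖v ω i‖ ^ 2)]

theorem col_sq_le (Mo : UplinkModel Ω K M 𝓢) (ω : Ω) (j : Fin K) :
    (∑ i, ‖Mo.H ω i j‖ ^ 2) ^ 2 ≤ M *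
      ∑ i, ∑ i', ‖(Matrix.of (Mo.H ω) * (Matrix.of (Mo.H ω))ᴴ) i i'‖ ^ 2 := by
  have h1 := sq_sum_le_card_mul_sum_sq (s := (Finset.univ : Finset (Fin M)))
    (f := fun i => ‖Mo.H ω i j‖ ^ 2)
  rw [Finset.card_univ, Fintype.card_fin] at h1
  refine h1.trans ?_
  gcongr with i _
  refine le_trans ?_ (Finset.single_le_sum
    (f := fun i' => ‖(Matrix.of (Mo.H ω) * (Matrix.of (Mo.H ω))ᴴ) i i'‖ ^ 2)
    (fun _ _ => by positivity) (Finset.mem_univ i))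
  have e : (Matrix.of (Mo.H ω) * (Matrix.of (Mo.H ω))ᴴ) i i
      = ((∑ j, ‖Mo.H ω i j‖ ^ 2 : ℝ) : ℂ) := by
    rw [Matrix.mul_apply, Complex.ofReal_sum]
    refine Finset.sum_congr rfl fun l _ => ?_
    rw [Matrix.conjTranspose_apply, ← Complex.normSq_eq_norm_sq, ← Complex.mul_conj]
    rfl
  simp only [e, Complex.norm_real]
  rw [Real.norm_of_nonneg (Finset.sum_nonneg fun _ _ => by positivity)]
  gcongr
  exact Finset.single_le_sum (f := fun j => ‖Mo.H ω i j‖ ^ 2) (fun _ _ => by positivity)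
      (Finset.mem_univ j)

theorem g_memLp (Mo : UplinkModel Ω K M 𝓢) {v : Ω → Fin M → ℂ} (hv : Mo.Admissible v)
    (j : Fin K) : MemLp (Mo.g j v) 2 ℙ := by
  have hm : Measurable (Mo.g j v) := (Mo.g_meas hv j).mono Mo.mHS_le le_rfl
  rw [memLp_two_iff_integrable_sq_norm hm.aestronglyMeasurable]
  obtain ⟨C, hC⟩ := Mo.hp_bdd
  refine Integrable.mono' (((Mo.hHHherm_L2.const_mul (M : ℝ)).add hv.2).const_mul C)
    (hm.norm.pow_const 2).aestronglyMeasurable ?_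
  filter_upwards [hC] with ω hω
  have hpn := Mo.hp_nonneg ω j
  have hpC := hω j
  have h1 := Mo.col_sq_le ω j
  rw [Real.norm_of_nonneg (by positivity)]
  simp only [Pi.add_apply]
  set Q := ∑ i, ∑ i', ‖(Matrix.of (Mo.H ω) * (Matrix.of (Mo.H ω))ᴴ) i i'‖ ^ 2
  have h2 : ‖∑ i, conj (Mo.H ω i j) * v ω i‖ ^ 2
      ≤ (∑ i, ‖Mo.H ω i j‖ ^ 2) * ∑ i, ‖v ω i‖ ^ 2 := by
    refine le_trans ?_ (Finset.sum_mul_sq_le_sq_mul_sq _ _ _)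
    gcongr
    refine (norm_sum_le _ _).trans (le_of_eq ?_)
    refine Finset.sum_congr rfl fun i _ => ?_
    rw [norm_mul, RCLike.norm_conj]
  have h3 : ‖Mo.g j v ω‖ ^ 2 = Mo.p ω j * ‖∑ i, conj (Mo.H ω i j) * v ω i‖ ^ 2 := by
    unfold g
    rw [norm_mul, mul_pow, Complex.norm_real, Real.norm_of_nonneg (Real.sqrt_nonneg _),
      Real.sq_sqrt hpn]
  rw [h3]
  set a := ∑ i, ‖Mo.H ω i j‖ ^ 2
  set b := ∑ i, ‖v ω i‖ ^ 2
  refine mul_le_mul hpC ?_ (by positivity) (hpn.trans hpC)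
  nlinarith [sq_nonneg (a - b), sq_nonneg a, sq_nonneg b]

/-- The total received power `∑ j, E|g j|² + E‖v‖²`. -/
def totPow (Mo : UplinkModel Ω K M 𝓢) (v : Ω → Fin M → ℂ) : ℝ :=
  (∑ j, ∫ ω, ‖Mo.g j v ω‖ ^ 2) + ∫ ω, ∑ i, ‖v ω i‖ ^ 2

theorem x_mXZ (Mo : UplinkModel Ω K M 𝓢) (j : Fin K) : Measurable[Mo.mXZ] (Mo.x j) := by
  have h : Measurable[MeasurableSpace.comap (Mo.x j) inferInstance] (Mo.x j) :=
    comap_measurable _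
  exact h.mono ((le_iSup (fun j => MeasurableSpace.comap (Mo.x j) inferInstance) j).trans
    le_sup_left) le_rfl

theorem z_mXZ (Mo : UplinkModel Ω K M 𝓢) : Measurable[Mo.mXZ] Mo.z := by
  have h : Measurable[MeasurableSpace.comap Mo.z inferInstance] Mo.z := comap_measurable _
  exact h.mono le_sup_right le_rfl

theorem cov (Mo : UplinkModel Ω K M 𝓢) (a b : Fin K ⊕ Fin M) :
    ∫ ω, (Sum.elim Mo.x (fun i ω => Mo.z ω i) a : Ω → ℂ) ω
      * conj ((Sum.elim Mo.x (fun i ω => Mo.z ω i) b : Ω → ℂ) ω) = if a = b then 1 else 0 := by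
  have hconj : Measurable (fun z : ℂ => conj z) := Complex.continuous_conj.measurable
  have hxm : ∀ j, Measurable[MeasurableSpace.comap (Mo.x j) inferInstance] (Mo.x j) :=
    fun j => comap_measurable _
  have hzm : ∀ i, Measurable[MeasurableSpace.comap Mo.z inferInstance] (fun ω => Mo.z ω i) :=
    fun i => (measurable_pi_apply i).comp (comap_measurable Mo.z)
  have hx := Mo.hx_meas
  have hz : ∀ i, Measurable fun ω => Mo.z ω i :=
    fun i => (measurable_pi_apply i).comp Mo.hz_meas
  rcases a with a | a <;> rcases b with b | b
  · by_cases hab : a = b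
    · subst hab
      simp only [Sum.elim_inl, if_true]
      have : ∀ ω, Mo.x a ω * conj (Mo.x a ω) = ((‖Mo.x a ω‖ ^ 2 : ℝ) : ℂ) := fun ω => by
        rw [Complex.mul_conj, Complex.normSq_eq_norm_sq]
      simp_rw [this]
      rw [integral_complex_ofReal, Mo.hx_var]; simp
    · simp only [Sum.elim_inl, Sum.inl.injEq, hab, if_false]
      rw [(indepFun_of_indep_meas (g := fun ω => conj (Mo.x b ω)) (Mo.indep_x_x hab) (hxm a)
        (hconj.comp (hxm b))).integral_fun_mul_eq_mul_integral
        (hx a).aestronglyMeasurable (hconj.comp (hx b)).aestronglyMeasurable, Mo.hx_mean]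
      simp
  · simp only [Sum.elim_inl, Sum.elim_inr, reduceCtorEq, if_false]
    rw [(indepFun_of_indep_meas (g := fun ω => conj (Mo.z ω b)) (Mo.indep_x_z a) (hxm a)
        (hconj.comp (hzm b))).integral_fun_mul_eq_mul_integral
        (hx a).aestronglyMeasurable (hconj.comp (hz b)).aestronglyMeasurable, Mo.hx_mean]
    simp
  · simp only [Sum.elim_inl, Sum.elim_inr, reduceCtorEq, if_false]
    rw [(indepFun_of_indep_meas (g := fun ω => conj (Mo.x b ω)) (Mo.indep_x_z b).symm (hzm a)
        (hconj.comp (hxm b))).integral_fun_mul_eq_mul_integral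
        (hz a).aestronglyMeasurable (hconj.comp (hx b)).aestronglyMeasurable, Mo.hz_mean]
    simp
  · simp only [Sum.elim_inr, Sum.inr.injEq]
    exact Mo.hz_cov a b

theorem MSE_eq (Mo : UplinkModel Ω K M 𝓢) {v : Ω → Fin M → ℂ} (hv : Mo.Admissible v)
    (k : Fin K) : Mo.MSE k v = 1 - 2 * (∫ ω, Mo.g k v ω).re + Mo.totPow v := by
  have hconj : Measurable (fun z : ℂ => conj z) := Complex.continuous_conj.measurable
  let d : Fin K → ℂ := fun j => if j = k then 1 else 0
  let c : Fin K ⊕ Fin M → Ω → ℂ :=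
    Sum.elim (fun j ω => d j - conj (Mo.g j v ω)) (fun i ω => - conj (v ω i))
  have hvi : ∀ i, Measurable[Mo.mHS] fun ω => v ω i :=
    fun i => (measurable_pi_apply i).comp (Mo.v_meas hv)
  have key := integral_sq_norm_combination Mo.indep_mHS_mXZ c
    (Sum.elim Mo.x (fun i ω => Mo.z ω i)) ?_ ?_ ?_ ?_ Mo.cov
  · have e : ∀ ω, Mo.x k ω - Mo.y v ω
        = ∑ a, c a ω * (Sum.elim Mo.x (fun i ω => Mo.z ω i) a : Ω → ℂ) ω := by
      intro ω
      rw [Fintype.sum_sum_type]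
      simp only [c, d, Sum.elim_inl, Sum.elim_inr, sub_mul, Finset.sum_sub_distrib, ite_mul,
        one_mul, zero_mul, Finset.sum_ite_eq', Finset.mem_univ, if_true, neg_mul,
        Finset.sum_neg_distrib, y, r, mul_add, Finset.sum_add_distrib]
      have : ∑ i, conj (v ω i) * ∑ j, (Real.sqrt (Mo.p ω j) : ℂ) * Mo.H ω i j * Mo.x j ω
          = ∑ j, conj (Mo.g j v ω) * Mo.x j ω := by
        simp only [g, map_mul, map_sum, Complex.conj_conj, Complex.conj_ofReal,
          Finset.mul_sum, Finset.sum_mul]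
        rw [Finset.sum_comm]
        refine Finset.sum_congr rfl fun i _ => Finset.sum_congr rfl fun j _ => ?_
        ring
      rw [this]; ring
    unfold MSE
    simp_rw [e]
    rw [key, Fintype.sum_sum_type]
    unfold totPow
    have hv2 : ∀ i, Integrable fun ω => ‖v ω i‖ ^ 2 := fun i =>
      (memLp_two_iff_integrable_sq_norm (Mo.v_memLp hv i).1).1 (Mo.v_memLp hv i)
    rw [integral_finsetSum _ fun i _ => hv2 i]
    simp only [c, Sum.elim_inl, Sum.elim_inr, norm_neg, RCLike.norm_conj]
    have hg2 : ∀ j, Integrable fun ω => ‖Mo.g j v ω‖ ^ 2 := fun j =>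
      (memLp_two_iff_integrable_sq_norm (Mo.g_memLp hv j).1).1 (Mo.g_memLp hv j)
    have hg1 : ∀ j, Integrable (Mo.g j v) := fun j =>
      (Mo.g_memLp hv j).integrable (by norm_num)
    have hj : ∀ j, ∫ ω, ‖d j - conj (Mo.g j v ω)‖ ^ 2
        = (if j = k then 1 - 2 * (∫ ω, Mo.g k v ω).re else 0) + ∫ ω, ‖Mo.g j v ω‖ ^ 2 := by
      intro j
      by_cases hjk : j = k
      · subst hjk
        simp only [d, if_true]
        have : ∀ ω, ‖1 - conj (Mo.g j v ω)‖ ^ 2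
            = (1 - 2 * (Mo.g j v ω).re) + ‖Mo.g j v ω‖ ^ 2 := by
          intro ω
          rw [← Complex.normSq_eq_norm_sq, ← Complex.normSq_eq_norm_sq, Complex.normSq_apply,
            Complex.normSq_apply]
          simp
          ring
        simp_rw [this]
        have hre : Integrable fun ω => (Mo.g j v ω).re := (hg1 j).re
        have hre' : ∫ ω, (Mo.g j v ω).re = (∫ ω, Mo.g j v ω).re := integral_re (hg1 j)
        have hs : Integrable fun ω => 1 - 2 * (Mo.g j v ω).re :=
          (integrable_const _).sub (hre.const_mul 2)
        rw [integral_add hs (hg2 j),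
          integral_sub (integrable_const _) (hre.const_mul 2), integral_const_mul, hre']
        simp
      · simp [d, hjk]
    simp_rw [hj]
    rw [Finset.sum_add_distrib, Finset.sum_ite_eq', if_pos (Finset.mem_univ _)]
    ring
  · rintro (j | i)
    · exact measurable_const.sub (hconj.comp (Mo.g_meas hv j))
    · exact (hconj.comp (hvi i)).neg
  · rintro (j | i)
    · exact Mo.x_mXZ j
    · exact (measurable_pi_apply i).comp Mo.z_mXZ
  · rintro (j | i)
    · exact (memLp_const _).sub (Mo.g_memLp hv j).star
    · exact (Mo.v_memLp hv i).star.neg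
  · rintro (j | i)
    · exact Mo.hx_L2 j
    · exact Mo.hz_L2 i

theorem SINR_eq (Mo : UplinkModel Ω K M 𝓢) (v : Ω → Fin M → ℂ) (k : Fin K) :
    Mo.SINR_UatF k v = ‖∫ ω, Mo.g k v ω‖ ^ 2 / (Mo.totPow v - ‖∫ ω, Mo.g k v ω‖ ^ 2) := by
  unfold SINR_UatF totPow
  rw [← Finset.add_sum_erase _ _ (Finset.mem_univ k)]
  congr 1
  ring

theorem jensen (Mo : UplinkModel Ω K M 𝓢) {v : Ω → Fin M → ℂ} (hv : Mo.Admissible v)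
    (k : Fin K) : ‖∫ ω, Mo.g k v ω‖ ^ 2 ≤ ∫ ω, ‖Mo.g k v ω‖ ^ 2 := by
  have hn : MemLp (fun ω => ‖Mo.g k v ω‖) 2 ℙ := (Mo.g_memLp hv k).norm
  have h := variance_eq_sub hn
  have h0 := variance_nonneg (fun ω => ‖Mo.g k v ω‖) (ℙ : Measure Ω)
  have h1 : ‖∫ ω, Mo.g k v ω‖ ≤ ∫ ω, ‖Mo.g k v ω‖ := norm_integral_le_integral_norm _
  have h2 : ‖∫ ω, Mo.g k v ω‖ ^ 2 ≤ (∫ ω, ‖Mo.g k v ω‖) ^ 2 := by gcongr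
  rw [h] at h0
  simp only [Pi.pow_apply] at h0
  linarith

theorem totPow_cases (Mo : UplinkModel Ω K M 𝓢) {v : Ω → Fin M → ℂ} (hv : Mo.Admissible v)
    (k : Fin K) : (Mo.totPow v = 0 ∧ ∫ ω, Mo.g k v ω = 0) ∨
      ‖∫ ω, Mo.g k v ω‖ ^ 2 < Mo.totPow v := by
  have hJ := Mo.jensen hv k
  have hs : ∫ ω, ‖Mo.g k v ω‖ ^ 2 ≤ ∑ j, ∫ ω, ‖Mo.g j v ω‖ ^ 2 :=
    Finset.single_le_sum (f := fun j => ∫ ω, ‖Mo.g j v ω‖ ^ 2)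
      (fun j _ => integral_nonneg fun ω => by positivity) (Finset.mem_univ k)
  have hv0 : ∀ ω, 0 ≤ ∑ i, ‖v ω i‖ ^ 2 := fun ω => Finset.sum_nonneg fun i _ => by positivity
  have hP : 0 ≤ ∫ ω, ∑ i, ‖v ω i‖ ^ 2 := integral_nonneg hv0
  rcases hP.lt_or_eq with hP | hP
  · right
    unfold totPow
    linarith
  · left
    have hv2 : Integrable fun ω => ∑ i, ‖v ω i‖ ^ 2 := integrable_finsetSum _ fun i _ =>
      (memLp_two_iff_integrable_sq_norm (Mo.v_memLp hv i).1).1 (Mo.v_memLp hv i)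
    have hz := (integral_eq_zero_iff_of_nonneg hv0 hv2).1 hP.symm
    have hg : ∀ j, Mo.g j v =ᵐ[ℙ] 0 := by
      intro j
      filter_upwards [hz] with ω hω
      have hi : ∀ i, v ω i = 0 := by
        intro i
        have := (Finset.sum_eq_zero_iff_of_nonneg
          (fun i _ => by positivity : ∀ i ∈ Finset.univ, 0 ≤ ‖v ω i‖ ^ 2)).1 hω i
          (Finset.mem_univ i)
        simpa using this
      simp [g, hi]
    constructor
    · unfold totPow
      rw [← hP, add_zero]
      refine Finset.sum_eq_zero fun j _ => integral_eq_zero_of_ae ?_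
      filter_upwards [hg j] with ω hω
      simp [hω]
    · exact integral_eq_zero_of_ae (hg k)

theorem g_smul (Mo : UplinkModel Ω K M 𝓢) (v : Ω → Fin M → ℂ) (α : ℂ) (j : Fin K) (ω : Ω) :
    Mo.g j (fun ω i => α * v ω i) ω = α * Mo.g j v ω := by
  simp only [g, Finset.mul_sum]
  exact Finset.sum_congr rfl fun i _ => by ring

theorem MSE_smul (Mo : UplinkModel Ω K M 𝓢) {v : Ω → Fin M → ℂ} (α : ℂ)
    (hv : Mo.Admissible (fun ω i => α * v ω i)) (k : Fin K) :
    Mo.MSE k (fun ω i => α * v ω i)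
      = 1 - 2 * (α * ∫ ω, Mo.g k v ω).re + ‖α‖ ^ 2 * Mo.totPow v := by
  rw [Mo.MSE_eq hv]
  unfold totPow
  simp only [g_smul, norm_mul, mul_pow, integral_const_mul, ← Finset.mul_sum, mul_add]

theorem SINR_nonneg (Mo : UplinkModel Ω K M 𝓢) {v : Ω → Fin M → ℂ} (hv : Mo.Admissible v)
    (k : Fin K) : 0 ≤ Mo.SINR_UatF k v := by
  rw [SINR_eq]
  rcases Mo.totPow_cases hv k with ⟨h, h'⟩ | h
  · simp [h']
  · exact div_nonneg (by positivity) (by linarith)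

theorem inv_le_MSE (Mo : UplinkModel Ω K M 𝓢) {v : Ω → Fin M → ℂ} (hv : Mo.Admissible v)
    (k : Fin K) : (1 + Mo.SINR_UatF k v)⁻¹ ≤ Mo.MSE k v := by
  rw [SINR_eq, Mo.MSE_eq hv]
  rcases Mo.totPow_cases hv k with ⟨h, h'⟩ | h
  · simp [h, h']
  · set A := ∫ ω, Mo.g k v ω
    set B := Mo.totPow v
    have hB : 0 < B := lt_of_le_of_lt (by positivity) h
    have hD : 0 < B - ‖A‖ ^ 2 := by linarith
    have e : (1 + ‖A‖ ^ 2 / (B - ‖A‖ ^ 2))⁻¹ = (B - ‖A‖ ^ 2) / B := by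
      field_simp
      simp
    rw [e, div_le_iff₀ hB]
    have hre : A.re ^ 2 ≤ ‖A‖ ^ 2 := by
      rw [← Complex.normSq_eq_norm_sq, Complex.normSq_apply]
      nlinarith [sq_nonneg A.im]
    nlinarith [sq_nonneg (B - A.re)]

theorem exists_scale (Mo : UplinkModel Ω K M 𝓢) {v : Ω → Fin M → ℂ} (hv : Mo.Admissible v)
    (hs : ∀ α : ℂ, Mo.Admissible (fun ω i => α * v ω i)) (k : Fin K) :
    ∃ α : ℂ, Mo.MSE k (fun ω i => α * v ω i) = (1 + Mo.SINR_UatF k v)⁻¹ := by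
  refine ⟨conj (∫ ω, Mo.g k v ω) / (Mo.totPow v : ℂ), ?_⟩
  rw [Mo.MSE_smul _ (hs _), SINR_eq]
  rcases Mo.totPow_cases hv k with ⟨h, h'⟩ | h
  · simp [h, h']
  · set A := ∫ ω, Mo.g k v ω
    set B := Mo.totPow v
    have hB : 0 < B := lt_of_le_of_lt (by positivity) h
    have hD : 0 < B - ‖A‖ ^ 2 := by linarith
    have e : (1 + ‖A‖ ^ 2 / (B - ‖A‖ ^ 2))⁻¹ = (B - ‖A‖ ^ 2) / B := by
      field_simp
      simp
    have e2 : conj A / (B : ℂ) * A = ((‖A‖ ^ 2 / B : ℝ) : ℂ) := by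
      rw [div_mul_eq_mul_div, mul_comm, Complex.mul_conj, Complex.normSq_eq_norm_sq]
      push_cast; rfl
    rw [e, e2, Complex.ofReal_re, norm_div, RCLike.norm_conj, Complex.norm_real,
      Real.norm_of_nonneg hB.le]
    field_simp
    ring

end UplinkModel

/-- For a nonempty set `𝒱` of admissible beamformers closed under
multiplication by complex scalars, as an identity in `[0, ∞]`,
`1 + sup_{v ∈ 𝒱} SINR_k^UatF(v) = (inf_{v ∈ 𝒱} MSE_k(v))⁻¹`.
Furthermore, any MSE minimizer over `𝒱` maximizes the UatF SINR over `𝒱`. -/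
theorem one_add_iSup_sinr_eq_inv_iInf_mse
    {Ω : Type*} [MeasureSpace Ω] [IsProbabilityMeasure (ℙ : Measure Ω)]
    {K M : ℕ} {𝓢 : Type*} [MeasurableSpace 𝓢]
    (Mo : UplinkModel Ω K M 𝓢) (k : Fin K)
    (𝒱 : Set (Ω → Fin M → ℂ)) (h𝒱ne : 𝒱.Nonempty)
    (h𝒱adm : ∀ v ∈ 𝒱, Mo.Admissible v)
    (h𝒱scal : ∀ v ∈ 𝒱, ∀ α : ℂ, (fun ω i => α * v ω i) ∈ 𝒱) :
    ((1 + ⨆ v : 𝒱, ENNReal.ofReal (Mo.SINR_UatF k (v : Ω → Fin M → ℂ))) =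
      (⨅ v : 𝒱, ENNReal.ofReal (Mo.MSE k (v : Ω → Fin M → ℂ)))⁻¹) ∧
    ∀ vopt ∈ 𝒱, (∀ v ∈ 𝒱, Mo.MSE k vopt ≤ Mo.MSE k v) →
      ∀ v ∈ 𝒱, Mo.SINR_UatF k v ≤ Mo.SINR_UatF k vopt := by
  have hpos : ∀ v ∈ 𝒱, 0 < 1 + Mo.SINR_UatF k v := fun v hv => by
    linarith [Mo.SINR_nonneg (h𝒱adm v hv) k]
  have hscale : ∀ v ∈ 𝒱, ∃ w ∈ 𝒱, Mo.MSE k w = (1 + Mo.SINR_UatF k v)⁻¹ := by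
    intro v hv
    obtain ⟨α, hα⟩ := Mo.exists_scale (h𝒱adm v hv) (fun α => h𝒱adm _ (h𝒱scal v hv α)) k
    exact ⟨_, h𝒱scal v hv α, hα⟩
  have hconv : ∀ v ∈ 𝒱, 1 + ENNReal.ofReal (Mo.SINR_UatF k v)
      = (ENNReal.ofReal (1 + Mo.SINR_UatF k v)⁻¹)⁻¹ := by
    intro v hv
    rw [ENNReal.ofReal_inv_of_pos (hpos v hv), inv_inv,
      ENNReal.ofReal_add zero_le_one (Mo.SINR_nonneg (h𝒱adm v hv) k), ENNReal.ofReal_one]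
  refine ⟨?_, ?_⟩
  · have : Nonempty 𝒱 := h𝒱ne.to_subtype
    rw [ENNReal.add_iSup, ENNReal.inv_iInf]
    apply le_antisymm
    · refine iSup_mono' fun v => ?_
      obtain ⟨w, hw, hwe⟩ := hscale v v.2
      exact ⟨⟨w, hw⟩, by rw [hconv v v.2, ← hwe]⟩
    · refine iSup_mono fun v => ?_
      rw [hconv v v.2, ENNReal.inv_le_inv]
      exact ENNReal.ofReal_le_ofReal (Mo.inv_le_MSE (h𝒱adm v v.2) k)
  · intro vopt hvo hmin v hv
    obtain ⟨w, hw, hwe⟩ := hscale v hv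
    have h1 := (Mo.inv_le_MSE (h𝒱adm vopt hvo) k).trans (hmin w hw)
    rw [hwe, inv_le_inv₀ (hpos _ hvo) (hpos _ hv)] at h1
    linarith
end
end

section
/- If v★ ∈ 𝒱_k attains the infimum of MSE_k over the information-constrained set 𝒱_k, then v★ attains the supremum over 𝒱_k of the use-and-then-forget ergodic rate R_k^UatF(v) := log(1 + SINR_k^UatF(v)). -/
open MeasureTheory ProbabilityTheory Matrix Finset
open scoped ENNReal ComplexConjugate MeasureTheory

noncomputable section

/-- The canonical uplink massive MIMO model with `K` users and `M = N·L` infrastructure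
antennas partitioned into `L` groups of `N` antennas (rows indexed by `Fin L × Fin N`),
with distributed CSI `S l` (the CSI of processing unit `l`) taking values in `𝓢 l`. -/
structure DistUplinkModel (Ω : Type*) [MeasureSpace Ω] (K N L : ℕ)
    (𝓢 : Fin L → Type*) [∀ l, MeasurableSpace (𝓢 l)] where
  x : Fin K → Ω → ℂ
  z : Ω → Fin L × Fin N → ℂ
  H : Ω → Fin L × Fin N → Fin K → ℂ
  S : ∀ l, Ω → 𝓢 l
  p : Ω → Fin K → ℝ
  hx_meas : ∀ j, Measurable (x j)
  hz_meas : Measurable z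
  hH_meas : Measurable H
  hS_meas : ∀ l, Measurable (S l)
  hx_L2 : ∀ j, MemLp (x j) 2 ℙ
  hz_L2 : ∀ i, MemLp (fun ω => z ω i) 2 ℙ
  hx_mean : ∀ j, ∫ ω, x j ω = 0
  hx_var : ∀ j, ∫ ω, ‖x j ω‖ ^ 2 = 1
  hz_mean : ∀ i, ∫ ω, z ω i = 0
  hz_cov : ∀ i i', ∫ ω, z ω i * conj (z ω i') = if i = i' then 1 else 0
  hp_nonneg : ∀ ω j, 0 ≤ p ω j
  hp_meas : Measurable[MeasurableSpace.comap (fun ω l => S l ω) inferInstance] p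
  hp_bdd : ∃ C : ℝ, ∀ᵐ ω, ∀ j, p ω j ≤ C
  /-- `(x 0, …, x (K-1))`, `z` and the pair `(H, S)` are mutually independent. -/
  hindep : iIndep (fun i : Fin K ⊕ Bool =>
    Sum.elim (fun j => MeasurableSpace.comap (x j) inferInstance)
      (fun b => if b then
          MeasurableSpace.comap (fun ω => (H ω, fun l => S l ω)) inferInstance
        else MeasurableSpace.comap z inferInstance) i) ℙ
  /-- `E[‖H Hᴴ‖_F²] < ∞`. -/
  hHHherm_L2 : Integrable (fun ω =>
    ∑ i, ∑ i', ‖(Matrix.of (H ω) * (Matrix.of (H ω))ᴴ) i i'‖ ^ 2)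

namespace DistUplinkModel

variable {Ω : Type*} [MeasureSpace Ω] {K N L : ℕ} {𝓢 : Fin L → Type*}
  [∀ l, MeasurableSpace (𝓢 l)]

/-- The σ-algebra `σ(S_l)` generated by the CSI of processing unit `l`. -/
def mS (Mo : DistUplinkModel Ω K N L 𝓢) (l : Fin L) : MeasurableSpace Ω :=
  MeasurableSpace.comap (Mo.S l) inferInstance

/-- The received uplink signal `r = ∑ j √(p j) • h j * x j + z`. -/
def r (Mo : DistUplinkModel Ω K N L 𝓢) (ω : Ω) : Fin L × Fin N → ℂ := fun i =>
  (∑ j, (Real.sqrt (Mo.p ω j) : ℂ) * Mo.H ω i j * Mo.x j ω) + Mo.z ω i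

/-- `g j v = √(p j) h jᴴ v`. -/
def g (Mo : DistUplinkModel Ω K N L 𝓢) (j : Fin K) (v : Ω → Fin L × Fin N → ℂ) (ω : Ω) : ℂ :=
  (Real.sqrt (Mo.p ω j) : ℂ) * ∑ i, conj (Mo.H ω i j) * v ω i

/-- `MSE k v = E[|x k − vᴴ r|²]`. -/
def MSE (Mo : DistUplinkModel Ω K N L 𝓢) (k : Fin K) (v : Ω → Fin L × Fin N → ℂ) : ℝ :=
  ∫ ω, ‖Mo.x k ω - ∑ i, conj (v ω i) * Mo.r ω i‖ ^ 2

/-- `MSE_k(v | U) = E[|x k − vᴴ r|² | U]`, as conditional expectation given the σ-algebra `m`. -/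
def MSEcond (Mo : DistUplinkModel Ω K N L 𝓢) (m : MeasurableSpace Ω) (k : Fin K)
    (v : Ω → Fin L × Fin N → ℂ) : Ω → ℝ :=
  ℙ[fun ω => ‖Mo.x k ω - ∑ i, conj (v ω i) * Mo.r ω i‖ ^ 2 | m]

/-- The use-and-then-forget SINR (with the convention `0/0 = 0`, which is automatic for real
division in Lean). -/
def SINR_UatF (Mo : DistUplinkModel Ω K N L 𝓢) (k : Fin K)
    (v : Ω → Fin L × Fin N → ℂ) : ℝ :=
  ‖∫ ω, Mo.g k v ω‖ ^ 2 /
    (((∫ ω, ‖Mo.g k v ω‖ ^ 2) - ‖∫ ω, Mo.g k v ω‖ ^ 2)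
      + (∑ j ∈ Finset.univ.erase k, ∫ ω, ‖Mo.g j v ω‖ ^ 2)
      + ∫ ω, ∑ i, ‖v ω i‖ ^ 2)

/-- The coherent-decoding conditional SINR given the σ-algebra `m` (generated by the decoder
side information), with the convention `0/0 = 0`. -/
def SINR_coh (Mo : DistUplinkModel Ω K N L 𝓢) (m : MeasurableSpace Ω) (k : Fin K)
    (v : Ω → Fin L × Fin N → ℂ) (ω : Ω) : ℝ :=
  ‖(ℙ[Mo.g k v | m]) ω‖ ^ 2 /
    (((ℙ[fun ω' => ‖Mo.g k v ω'‖ ^ 2 | m]) ω - ‖(ℙ[Mo.g k v | m]) ω‖ ^ 2)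
      + (∑ j ∈ Finset.univ.erase k, (ℙ[fun ω' => ‖Mo.g j v ω'‖ ^ 2 | m]) ω)
      + (ℙ[fun ω' => ∑ i, ‖v ω' i‖ ^ 2 | m]) ω)

/-- The information-constrained beamforming set `𝒱_k`: for `l` in the serving cluster `Lk`,
the block `v_l` is `σ(S_l)`-measurable with `E[‖v_l‖⁴] < ∞`, and `v_l = 0` a.s. otherwise. -/
def Vset (Mo : DistUplinkModel Ω K N L 𝓢) (Lk : Finset (Fin L)) :
    Set (Ω → Fin L × Fin N → ℂ) :=
  { v | (∀ l ∈ Lk,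
          Measurable[Mo.mS l] (fun ω (n : Fin N) => v ω (l, n)) ∧
          Integrable (fun ω => (∑ n, ‖v ω (l, n)‖ ^ 2) ^ 2)) ∧
        ∀ l ∉ Lk, ∀ᵐ ω, ∀ n, v ω (l, n) = 0 }

end DistUplinkModel

namespace DistUplinkModel

/-- Finite-dimensional optimisation core. -/
lemma ratio_core (b b' : ℂ) (A A' : ℝ) 
    (hD0 : 0 ≤ A - ‖b‖ ^ 2) (hDz : A - ‖b‖ ^ 2 = 0 → b = 0)
    (hD0' : 0 ≤ A' - ‖b'‖ ^ 2) (hDz' : A' - ‖b'‖ ^ 2 = 0 → b' = 0)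
    (h : ∀ c : ℂ, 1 - 2 * b'.re + A' ≤ 1 - 2 * (c * b).re + ‖c‖ ^ 2 * A) :
    ‖b‖ ^ 2 / (A - ‖b‖ ^ 2) ≤ ‖b'‖ ^ 2 / (A' - ‖b'‖ ^ 2) := by
  by_cases hb : b = 0
  · subst hb
    simp only [norm_zero, ne_eq, OfNat.ofNat_ne_zero, not_false_eq_true, zero_pow, zero_div]
    positivity
  have hD : 0 < A - ‖b‖ ^ 2 := lt_of_le_of_ne hD0 (fun e => hb (hDz e.symm))
  have hn : 0 < ‖b‖ ^ 2 := by positivity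
  have hA : 0 < A := by linarith
  have h1 := h ((‖b‖ ^ 2 / A : ℝ) * b⁻¹)
  rw [mul_assoc, inv_mul_cancel₀ hb, mul_one, Complex.ofReal_re, norm_mul, norm_inv,
    Complex.norm_real, Real.norm_eq_abs, abs_of_pos (by positivity)] at h1
  have h2 : (‖b‖ ^ 2 / A * ‖b‖⁻¹) ^ 2 * A = ‖b‖ ^ 2 / A := by
    have : ‖b‖ ≠ 0 := by simpa using hb
    field_simp
  rw [h2] at h1
  have hre : b'.re ≤ ‖b'‖ := Complex.re_le_norm b'
  set s := ‖b'‖ with hs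
  set n := ‖b‖ ^ 2 with hnn
  have hpos : 0 < n / A := by positivity
  have hb' : b' ≠ 0 := by
    intro e
    have hs0 : s = 0 := by rw [hs, e]; simp
    rw [hs0] at hre hD0'
    nlinarith
  have hD' : 0 < A' - s ^ 2 := lt_of_le_of_ne hD0' (fun e => hb' (hDz' e.symm))
  have hA' : 0 < A' := by nlinarith [sq_nonneg s]
  have h3 : n / A ≤ 2 * s - A' := by linarith
  have h4 : 2 * s - A' ≤ s ^ 2 / A' := by
    rw [le_div_iff₀ hA']; nlinarith [sq_nonneg (s - A')]
  have h5 : n / A ≤ s ^ 2 / A' := h3.trans h4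
  rw [div_le_div_iff₀ hA hA'] at h5
  rw [div_le_div_iff₀ hD hD']
  nlinarith

/-- Orthonormal, independent expansion. -/
lemma ortho_expansion {Ω : Type*} (m₁ m₂ : MeasurableSpace Ω) {mΩ : MeasurableSpace Ω}
    {μ : Measure Ω}
    [IsProbabilityMeasure μ] {ι : Type*} [Fintype ι] [DecidableEq ι]
    (hm₁ : m₁ ≤ mΩ) (hm₂ : m₂ ≤ mΩ) (hind : Indep m₁ m₂ μ)
    (a w : ι → Ω → ℂ) (ha : ∀ s, Measurable[m₁] (a s)) (hw : ∀ s, Measurable[m₂] (w s))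
    (ha2 : ∀ s, MemLp (a s) 2 μ) (hw2 : ∀ s, MemLp (w s) 2 μ)
    (hww : ∀ s t, ∫ ω, w s ω * conj (w t ω) ∂μ = if s = t then 1 else 0) :
    ∫ ω, ‖∑ s, a s ω * w s ω‖ ^ 2 ∂μ = ∑ s, ∫ ω, ‖a s ω‖ ^ 2 ∂μ := by
  have hmc : Measurable (fun x : ℂ => conj x) := Complex.continuous_conj.measurable
  have key : ∀ s t, Integrable (fun ω => (a s ω * conj (a t ω)) * (w s ω * conj (w t ω))) μ ∧
      ∫ ω, (a s ω * conj (a t ω)) * (w s ω * conj (w t ω)) ∂μ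
        = (∫ ω, a s ω * conj (a t ω) ∂μ) * (if s = t then 1 else 0) := by
    intro s t
    have hA : Measurable[m₁] (fun ω => a s ω * conj (a t ω)) :=
      (ha s).mul (hmc.comp (ha t))
    have hW : Measurable[m₂] (fun ω => w s ω * conj (w t ω)) :=
      (hw s).mul (hmc.comp (hw t))
    have hI : IndepFun (fun ω => a s ω * conj (a t ω)) (fun ω => w s ω * conj (w t ω)) μ := by
      rw [IndepFun_iff_Indep]
      exact indep_of_indep_of_le_left (indep_of_indep_of_le_right hind hW.comap_le) hA.comap_le
    have hAi : Integrable (fun ω => a s ω * conj (a t ω)) μ :=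
      (ha2 s).integrable_mul (ha2 t).star
    have hWi : Integrable (fun ω => w s ω * conj (w t ω)) μ :=
      (hw2 s).integrable_mul (hw2 t).star
    refine ⟨hI.integrable_mul hAi hWi, ?_⟩
    rw [← hww s t]
    exact hI.integral_fun_mul_eq_mul_integral hAi.1 hWi.1
  have e1 : ∀ ω, ((‖∑ s, a s ω * w s ω‖ ^ 2 : ℝ) : ℂ)
      = ∑ s, ∑ t, (a s ω * conj (a t ω)) * (w s ω * conj (w t ω)) := by
    intro ω
    rw [Complex.ofReal_pow, ← Complex.mul_conj', map_sum, Finset.sum_mul_sum]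
    refine Finset.sum_congr rfl fun s _ => Finset.sum_congr rfl fun t _ => ?_
    rw [map_mul]; ring
  have e2 : ((∫ ω, ‖∑ s, a s ω * w s ω‖ ^ 2 ∂μ : ℝ) : ℂ)
      = ((∑ s, ∫ ω, ‖a s ω‖ ^ 2 ∂μ : ℝ) : ℂ) := by
    rw [← integral_complex_ofReal]
    simp_rw [e1]
    rw [integral_finsetSum _ (fun s _ => integrable_finsetSum _ (fun t _ => (key s t).1))]
    rw [Complex.ofReal_sum]
    refine Finset.sum_congr rfl fun s _ => ?_
    rw [integral_finsetSum _ (fun t _ => (key s t).1)]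
    simp_rw [(key s _).2]
    simp only [mul_ite, mul_one, mul_zero, Finset.sum_ite_eq, Finset.mem_univ, if_true]
    rw [← integral_complex_ofReal]
    refine integral_congr_ae (ae_of_all _ fun ω => ?_)
    simp only [Complex.ofReal_pow]
    rw [Complex.mul_conj']
  exact_mod_cast e2

variable {Ω : Type*} [MeasureSpace Ω] {K N L : ℕ} {𝓢 : Fin L → Type*}
  [∀ l, MeasurableSpace (𝓢 l)]

/-- σ-algebra of `(H, S)`. -/
def mHS (Mo : DistUplinkModel Ω K N L 𝓢) : MeasurableSpace Ω :=
  MeasurableSpace.comap (fun ω => (Mo.H ω, fun l => Mo.S l ω)) inferInstance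

/-- The noise and the symbols jointly. -/
def w (Mo : DistUplinkModel Ω K N L 𝓢) : Fin K ⊕ (Fin L × Fin N) → Ω → ℂ
  | Sum.inl j => Mo.x j
  | Sum.inr i => fun ω => Mo.z ω i

/-- The family of σ-algebras in the independence hypothesis. -/
def mfam (Mo : DistUplinkModel Ω K N L 𝓢) (i : Fin K ⊕ Bool) : MeasurableSpace Ω :=
    Sum.elim (fun j => MeasurableSpace.comap (Mo.x j) inferInstance)
      (fun b => if b then
          MeasurableSpace.comap (fun ω => (Mo.H ω, fun l => Mo.S l ω)) inferInstance
        else MeasurableSpace.comap Mo.z inferInstance) i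

lemma mHS_le (Mo : DistUplinkModel Ω K N L 𝓢) : Mo.mHS ≤ MeasureSpace.toMeasurableSpace :=
  (Mo.hH_meas.prodMk (measurable_pi_lambda _ Mo.hS_meas)).comap_le

lemma mfam_le (Mo : DistUplinkModel Ω K N L 𝓢) (i) :
    Mo.mfam i ≤ MeasureSpace.toMeasurableSpace := by
  rcases i with j | b
  · exact (Mo.hx_meas j).comap_le
  · cases b
    · simpa [mfam] using Mo.hz_meas.comap_le
    · simpa [mfam, mHS] using Mo.mHS_le

lemma w_meas (Mo : DistUplinkModel Ω K N L 𝓢) (s) :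
    Measurable[⨆ i ∈ {i : Fin K ⊕ Bool | i ≠ Sum.inr true}, Mo.mfam i] (Mo.w s) := by
  rcases s with j | i
  · have : Mo.mfam (Sum.inl j) ≤ ⨆ i ∈ {i : Fin K ⊕ Bool | i ≠ Sum.inr true}, Mo.mfam i :=
      le_iSup₂_of_le (Sum.inl j) (by simp) le_rfl
    exact (comap_measurable (Mo.x j)).mono this le_rfl
  · have : Mo.mfam (Sum.inr false) ≤ ⨆ i ∈ {i : Fin K ⊕ Bool | i ≠ Sum.inr true}, Mo.mfam i :=
      le_iSup₂_of_le (Sum.inr false) (by simp) le_rfl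
    exact ((measurable_pi_apply i).comp (comap_measurable Mo.z)).mono
      (le_trans (by simp [mfam]) this) le_rfl

lemma indep_w (Mo : DistUplinkModel Ω K N L 𝓢) :
    Indep Mo.mHS (⨆ i ∈ {i : Fin K ⊕ Bool | i ≠ Sum.inr true}, Mo.mfam i) ℙ := by
  have h := indep_iSup_of_disjoint Mo.mfam_le Mo.hindep
    (S := {Sum.inr true}) (T := {i : Fin K ⊕ Bool | i ≠ Sum.inr true})
    (by simp)
  have e : (⨆ i ∈ ({Sum.inr true} : Set (Fin K ⊕ Bool)), Mo.mfam i) = Mo.mHS := by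
    simp [mfam, mHS]
  rwa [e] at h

lemma w_L2 (Mo : DistUplinkModel Ω K N L 𝓢) (s) : MemLp (Mo.w s) 2 ℙ := by
  rcases s with j | i
  · exact Mo.hx_L2 j
  · exact Mo.hz_L2 i

lemma w_mean (Mo : DistUplinkModel Ω K N L 𝓢) (s) : ∫ ω, Mo.w s ω = 0 := by
  rcases s with j | i
  · exact Mo.hx_mean j
  · exact Mo.hz_mean i

lemma w_cross (Mo : DistUplinkModel Ω K N L 𝓢) (s t) (i j : Fin K ⊕ Bool) (hij : i ≠ j)
    (hs : Measurable[Mo.mfam i] (Mo.w s)) (ht : Measurable[Mo.mfam j] (Mo.w t)) :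
    ∫ ω, Mo.w s ω * conj (Mo.w t ω) = 0 := by
  have hmc : Measurable (fun x : ℂ => conj x) := Complex.continuous_conj.measurable
  have hI : IndepFun (Mo.w s) (fun ω => conj (Mo.w t ω)) ℙ := by
    rw [IndepFun_iff_Indep]
    exact indep_of_indep_of_le_left (indep_of_indep_of_le_right
      (iIndep.indep (m := Mo.mfam) Mo.hindep hij) (hmc.comp ht).comap_le) hs.comap_le
  rw [hI.integral_fun_mul_eq_mul_integral (Mo.w_L2 s).1 (Mo.w_L2 t).star.1, Mo.w_mean s, zero_mul]

lemma w_cov (Mo : DistUplinkModel Ω K N L 𝓢) (s t) :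
    ∫ ω, Mo.w s ω * conj (Mo.w t ω) = if s = t then 1 else 0 := by
  have mx : ∀ j, Measurable[Mo.mfam (Sum.inl j)] (Mo.w (Sum.inl j)) := fun j =>
    comap_measurable (Mo.x j)
  have mz : ∀ i, Measurable[Mo.mfam (Sum.inr false)] (Mo.w (Sum.inr i)) := fun i =>
    ((measurable_pi_apply i).comp (comap_measurable Mo.z)).mono (by simp [mfam]) le_rfl
  rcases s with j | i <;> rcases t with j' | i'
  · by_cases h : j = j'
    · subst h
      simp only [if_true, w, Complex.mul_conj']
      have := Mo.hx_var j
      rw [← Complex.ofReal_inj, ← integral_complex_ofReal] at this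
      simpa using this
    · rw [if_neg (by simpa using h)]
      exact Mo.w_cross _ _ _ _ (by simpa using h) (mx j) (mx j')
  · rw [if_neg (by simp)]
    exact Mo.w_cross _ _ _ _ (by simp) (mx j) (mz i')
  · rw [if_neg (by simp)]
    exact Mo.w_cross _ _ _ _ (by simp) (mz i) (mx j')
  · simpa [w] using Mo.hz_cov i i'

/-- Regular beamformers. -/
def Good (Mo : DistUplinkModel Ω K N L 𝓢) (v : Ω → Fin L × Fin N → ℂ) : Prop :=
  ∀ i, Measurable[Mo.mHS] (fun ω => v ω i) ∧ Integrable (fun ω => ‖v ω i‖ ^ 4)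

lemma H_meas' (Mo : DistUplinkModel Ω K N L 𝓢) (i j) :
    Measurable[Mo.mHS] (fun ω => Mo.H ω i j) := by
  have h : Measurable[Mo.mHS] (fun ω => (Mo.H ω, fun l => Mo.S l ω)) := comap_measurable _
  have h2 : Measurable (fun q : (Fin L × Fin N → Fin K → ℂ) × (∀ l, 𝓢 l) => q.1 i j) := by
    fun_prop
  exact h2.comp h

lemma S_le (Mo : DistUplinkModel Ω K N L 𝓢) :
    MeasurableSpace.comap (fun ω l => Mo.S l ω) inferInstance ≤ Mo.mHS := by
  have h : Measurable[Mo.mHS] (fun ω => (Mo.H ω, fun l => Mo.S l ω)) := comap_measurable _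
  exact (measurable_snd.comp h).comap_le

lemma mS_le (Mo : DistUplinkModel Ω K N L 𝓢) (l) : Mo.mS l ≤ Mo.mHS := by
  refine le_trans ?_ Mo.S_le
  exact ((measurable_pi_apply l).comp (comap_measurable (fun ω l => Mo.S l ω))).comap_le

lemma p_meas' (Mo : DistUplinkModel Ω K N L 𝓢) (j) :
    Measurable[Mo.mHS] (fun ω => Mo.p ω j) :=
  ((measurable_pi_apply j).comp Mo.hp_meas).mono Mo.S_le le_rfl

lemma H_L4 (Mo : DistUplinkModel Ω K N L 𝓢) (i j) :
    Integrable (fun ω => ‖Mo.H ω i j‖ ^ 4) := by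
  refine Mo.hHHherm_L2.mono'
    (((Mo.H_meas' i j).mono Mo.mHS_le le_rfl).norm.pow_const 4).aestronglyMeasurable
    (ae_of_all _ fun ω => ?_)
  rw [Real.norm_of_nonneg (by positivity)]
  have h1 : ‖(Matrix.of (Mo.H ω) * (Matrix.of (Mo.H ω))ᴴ) i i‖ = ∑ j, ‖Mo.H ω i j‖ ^ 2 := by
    have : (Matrix.of (Mo.H ω) * (Matrix.of (Mo.H ω))ᴴ) i i
        = ((∑ j, ‖Mo.H ω i j‖ ^ 2 : ℝ) : ℂ) := by
      rw [Matrix.mul_apply, Complex.ofReal_sum]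
      refine Finset.sum_congr rfl fun j _ => ?_
      rw [Matrix.conjTranspose_apply, Matrix.of_apply, Complex.ofReal_pow, ← Complex.mul_conj']
      rfl
    rw [this, Complex.norm_real, Real.norm_of_nonneg (by positivity)]
  have h2 : ‖Mo.H ω i j‖ ^ 2 ≤ ∑ j, ‖Mo.H ω i j‖ ^ 2 :=
    Finset.single_le_sum (f := fun j => ‖Mo.H ω i j‖ ^ 2) (fun _ _ => by positivity)
      (Finset.mem_univ j)
  calc ‖Mo.H ω i j‖ ^ 4 = (‖Mo.H ω i j‖ ^ 2) ^ 2 := by ring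
    _ ≤ (∑ j, ‖Mo.H ω i j‖ ^ 2) ^ 2 := by gcongr
    _ = ‖(Matrix.of (Mo.H ω) * (Matrix.of (Mo.H ω))ᴴ) i i‖ ^ 2 := by rw [h1]
    _ ≤ ∑ i', ‖(Matrix.of (Mo.H ω) * (Matrix.of (Mo.H ω))ᴴ) i i'‖ ^ 2 :=
      Finset.single_le_sum (f := fun i' => ‖(Matrix.of (Mo.H ω) * (Matrix.of (Mo.H ω))ᴴ) i i'‖ ^ 2)
        (fun _ _ => by positivity) (Finset.mem_univ i)
    _ ≤ _ := Finset.single_le_sum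
        (f := fun i => ∑ i', ‖(Matrix.of (Mo.H ω) * (Matrix.of (Mo.H ω))ᴴ) i i'‖ ^ 2)
        (fun _ _ => by positivity) (Finset.mem_univ i)

lemma Good.v_L2 [IsProbabilityMeasure (ℙ : Measure Ω)] {Mo : DistUplinkModel Ω K N L 𝓢}
    {v : Ω → Fin L × Fin N → ℂ} (hv : Mo.Good v) (i) : MemLp (fun ω => v ω i) 2 ℙ := by
  have hm := (hv i).1.mono Mo.mHS_le le_rfl
  rw [memLp_two_iff_integrable_sq_norm hm.aestronglyMeasurable]
  refine ((integrable_const (1 : ℝ)).add (hv i).2).mono'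
    (hm.norm.pow_const 2).aestronglyMeasurable (ae_of_all _ fun ω => ?_)
  rw [Real.norm_of_nonneg (by positivity)]
  simp only [Pi.add_apply]
  nlinarith [sq_nonneg (‖v ω i‖ ^ 2 - 1)]

lemma Good.g_meas {Mo : DistUplinkModel Ω K N L 𝓢}
    {v : Ω → Fin L × Fin N → ℂ} (hv : Mo.Good v) (j) : Measurable[Mo.mHS] (Mo.g j v) := by
  have hmc : Measurable (fun x : ℂ => conj x) := Complex.continuous_conj.measurable
  unfold g
  refine Measurable.mul (Complex.measurable_ofReal.comp
    (Real.continuous_sqrt.measurable.comp (Mo.p_meas' j))) ?_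
  exact Finset.measurable_fun_sum _ fun i _ => (hmc.comp (Mo.H_meas' i j)).mul (hv i).1

lemma Good.g_L2 [IsProbabilityMeasure (ℙ : Measure Ω)] {Mo : DistUplinkModel Ω K N L 𝓢}
    {v : Ω → Fin L × Fin N → ℂ} (hv : Mo.Good v) (j) : MemLp (Mo.g j v) 2 ℙ := by
  have hmc : Measurable (fun x : ℂ => conj x) := Complex.continuous_conj.measurable
  have hsum : MemLp (fun ω => ∑ i, conj (Mo.H ω i j) * v ω i) 2 ℙ := by
    refine memLp_finsetSum _ fun i _ => ?_
    have hm : Measurable (fun ω => conj (Mo.H ω i j) * v ω i) :=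
      ((hmc.comp (Mo.H_meas' i j)).mul (hv i).1).mono Mo.mHS_le le_rfl
    rw [memLp_two_iff_integrable_sq_norm hm.aestronglyMeasurable]
    refine ((Mo.H_L4 i j).add (hv i).2).mono'
      (hm.norm.pow_const 2).aestronglyMeasurable (ae_of_all _ fun ω => ?_)
    rw [Real.norm_of_nonneg (by positivity), norm_mul, RCLike.norm_conj, mul_pow]
    simp only [Pi.add_apply]
    nlinarith [sq_nonneg (‖v ω i‖ ^ 2 - ‖Mo.H ω i j‖ ^ 2), sq_nonneg (‖v ω i‖ ^ 2),
      sq_nonneg (‖Mo.H ω i j‖ ^ 2)]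
  obtain ⟨C, hC⟩ := Mo.hp_bdd
  refine hsum.of_le_mul (c := Real.sqrt C)
    ((hv.g_meas j).mono Mo.mHS_le le_rfl).aestronglyMeasurable ?_
  filter_upwards [hC] with ω hω
  rw [g, norm_mul, Complex.norm_real, Real.norm_of_nonneg (Real.sqrt_nonneg _)]
  gcongr
  exact hω j

/-- Total second moment. -/
def A (Mo : DistUplinkModel Ω K N L 𝓢) (v : Ω → Fin L × Fin N → ℂ) : ℝ :=
  (∑ j, ∫ ω, ‖Mo.g j v ω‖ ^ 2) + ∫ ω, ∑ i, ‖v ω i‖ ^ 2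

lemma Good.MSE_eq [IsProbabilityMeasure (ℙ : Measure Ω)] {Mo : DistUplinkModel Ω K N L 𝓢}
    {v : Ω → Fin L × Fin N → ℂ} (hv : Mo.Good v) (k) :
    Mo.MSE k v = 1 - 2 * (∫ ω, Mo.g k v ω).re + Mo.A v := by
  have hmc : Measurable (fun x : ℂ => conj x) := Complex.continuous_conj.measurable
  set a : Fin K ⊕ (Fin L × Fin N) → Ω → ℂ := Sum.elim
    (fun j ω => (if j = k then 1 else 0) - conj (Mo.g j v ω)) (fun i ω => - conj (v ω i)) with ha
  have e1 : ∀ ω, Mo.x k ω - ∑ i, conj (v ω i) * Mo.r ω i = ∑ s, a s ω * Mo.w s ω := by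
    intro ω
    rw [Fintype.sum_sum_type]
    simp only [ha, Sum.elim_inl, Sum.elim_inr, w, r, g, sub_mul, Finset.sum_sub_distrib, ite_mul,
      one_mul, zero_mul, Finset.sum_ite_eq', Finset.mem_univ, if_true, map_mul, map_sum,
      Complex.conj_ofReal, Complex.conj_conj, mul_add, Finset.sum_add_distrib, neg_mul,
      Finset.sum_neg_distrib, Finset.mul_sum, Finset.sum_mul]
    rw [Finset.sum_comm, sub_add_eq_sub_sub, ← sub_eq_add_neg]
    congr 2
    refine Finset.sum_congr rfl fun s _ => Finset.sum_congr rfl fun t _ => ?_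
    ring
  have hE := ortho_expansion Mo.mHS _ Mo.mHS_le (iSup₂_le fun i _ => Mo.mfam_le i) Mo.indep_w
    a Mo.w (by
      rintro (j | i)
      · exact measurable_const.sub (hmc.comp (hv.g_meas j))
      · exact (hmc.comp (hv i).1).neg) Mo.w_meas (by
      rintro (j | i)
      · exact (memLp_const _).sub (hv.g_L2 j).star
      · exact (hv.v_L2 i).star.neg) Mo.w_L2 Mo.w_cov
  rw [MSE]
  simp_rw [e1]
  rw [hE, Fintype.sum_sum_type, A]
  have hj : ∀ j, ∫ ω, ‖a (Sum.inl j) ω‖ ^ 2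
      = (if j = k then 1 - 2 * (∫ ω, Mo.g k v ω).re else 0) + ∫ ω, ‖Mo.g j v ω‖ ^ 2 := by
    intro j
    by_cases h : j = k
    · subst h
      have : ∀ ω, ‖a (Sum.inl j) ω‖ ^ 2
          = 1 - 2 * RCLike.re (Mo.g j v ω) + ‖Mo.g j v ω‖ ^ 2 := by
        intro ω
        simp only [ha, Sum.elim_inl, if_true]
        rw [← Complex.normSq_eq_norm_sq, ← Complex.normSq_eq_norm_sq, Complex.normSq_apply,
          Complex.normSq_apply]
        simp
        ring
      simp_rw [this]
      have hi : Integrable (Mo.g j v) ℙ := (hv.g_L2 j).integrable (by norm_num)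
      rw [integral_add, integral_sub, integral_const_mul, integral_re hi]
      · simp
      · exact integrable_const _
      · exact hi.re.const_mul 2
      · exact (integrable_const _).sub (hi.re.const_mul 2)
      · exact (hv.g_L2 j).integrable_norm_pow (by norm_num)
    · simp [ha, h]
  simp_rw [hj]
  rw [Finset.sum_add_distrib, integral_finsetSum _
    (fun i _ => (hv.v_L2 i).integrable_norm_pow (by norm_num))]
  simp [ha, add_assoc]

lemma Good.smul {Mo : DistUplinkModel Ω K N L 𝓢}
    {v : Ω → Fin L × Fin N → ℂ} (hv : Mo.Good v) (c : ℂ) : Mo.Good (fun ω i => c * v ω i) := by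
  intro i
  refine ⟨(hv i).1.const_mul c, ?_⟩
  simp_rw [norm_mul, mul_pow]
  exact (hv i).2.const_mul _

lemma g_smul (Mo : DistUplinkModel Ω K N L 𝓢) (v : Ω → Fin L × Fin N → ℂ) (c : ℂ) (j ω) :
    Mo.g j (fun ω i => c * v ω i) ω = c * Mo.g j v ω := by
  simp only [g, Finset.mul_sum]
  refine Finset.sum_congr rfl fun i _ => by ring

lemma A_smul (Mo : DistUplinkModel Ω K N L 𝓢) (v : Ω → Fin L × Fin N → ℂ) (c : ℂ) :
    Mo.A (fun ω i => c * v ω i) = ‖c‖ ^ 2 * Mo.A v := by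
  simp only [A, g_smul, norm_mul, mul_pow, ← Finset.mul_sum, integral_const_mul, mul_add]

lemma SINR_eq (Mo : DistUplinkModel Ω K N L 𝓢) (v : Ω → Fin L × Fin N → ℂ) (k) :
    Mo.SINR_UatF k v = ‖∫ ω, Mo.g k v ω‖ ^ 2 / (Mo.A v - ‖∫ ω, Mo.g k v ω‖ ^ 2) := by
  rw [SINR_UatF, A, ← Finset.add_sum_erase _ _ (Finset.mem_univ k)]
  congr 1
  ring

lemma Good.D_ge [IsProbabilityMeasure (ℙ : Measure Ω)] {Mo : DistUplinkModel Ω K N L 𝓢}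
    {v : Ω → Fin L × Fin N → ℂ} (hv : Mo.Good v) (k) :
    ∫ ω, ∑ i, ‖v ω i‖ ^ 2 ≤ Mo.A v - ‖∫ ω, Mo.g k v ω‖ ^ 2 := by
  have h1 : ‖∫ ω, Mo.g k v ω‖ ^ 2 ≤ ∫ ω, ‖Mo.g k v ω‖ ^ 2 := by
    have h := variance_nonneg (fun ω => ‖Mo.g k v ω‖) ℙ
    rw [variance_eq_sub (hv.g_L2 k).norm] at h
    have h' : ‖∫ ω, Mo.g k v ω‖ ^ 2 ≤ (∫ ω, ‖Mo.g k v ω‖) ^ 2 := by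
      gcongr
      exact norm_integral_le_integral_norm _
    simp only [Pi.pow_apply] at h
    linarith
  have h2 : ∫ ω, ‖Mo.g k v ω‖ ^ 2 ≤ ∑ j, ∫ ω, ‖Mo.g j v ω‖ ^ 2 :=
    Finset.single_le_sum (f := fun j => ∫ ω, ‖Mo.g j v ω‖ ^ 2)
      (fun _ _ => integral_nonneg fun _ => by positivity) (Finset.mem_univ k)
  rw [A]; linarith

lemma Good.D_nonneg [IsProbabilityMeasure (ℙ : Measure Ω)] {Mo : DistUplinkModel Ω K N L 𝓢}
    {v : Ω → Fin L × Fin N → ℂ} (hv : Mo.Good v) (k) :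
    0 ≤ Mo.A v - ‖∫ ω, Mo.g k v ω‖ ^ 2 :=
  le_trans (integral_nonneg fun _ => by positivity) (hv.D_ge k)

lemma Good.D_zero [IsProbabilityMeasure (ℙ : Measure Ω)] {Mo : DistUplinkModel Ω K N L 𝓢}
    {v : Ω → Fin L × Fin N → ℂ} (hv : Mo.Good v) (k)
    (h : Mo.A v - ‖∫ ω, Mo.g k v ω‖ ^ 2 = 0) : ∫ ω, Mo.g k v ω = 0 := by
  have h0 : ∫ ω, ∑ i, ‖v ω i‖ ^ 2 = 0 :=
    le_antisymm (h ▸ hv.D_ge k) (integral_nonneg fun _ => by positivity)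
  rw [integral_eq_zero_iff_of_nonneg (fun _ => by positivity)
    (integrable_finsetSum _ fun i _ => (hv.v_L2 i).integrable_norm_pow (by norm_num))] at h0
  refine integral_eq_zero_of_ae ?_
  filter_upwards [h0] with ω hω
  simp only [Pi.zero_apply] at hω
  rw [Finset.sum_eq_zero_iff_of_nonneg (fun _ _ => by positivity)] at hω
  have hz : ∀ i, v ω i = 0 := fun i => by simpa using hω i (Finset.mem_univ i)
  simp [g, hz]

/-- Every admissible beamformer is a.e. equal to a regular one. -/
lemma exists_good (Mo : DistUplinkModel Ω K N L 𝓢) (Lk : Finset (Fin L))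
    (v : Ω → Fin L × Fin N → ℂ) (hv : v ∈ Mo.Vset Lk) :
    ∃ v', Mo.Good v' ∧ v' ∈ Mo.Vset Lk ∧ v =ᵐ[ℙ] v' := by
  classical
  refine ⟨fun ω i => if i.1 ∈ Lk then v ω i else 0, ?_, ⟨?_, ?_⟩, ?_⟩
  · rintro ⟨l, n⟩
    by_cases hl : l ∈ Lk
    · obtain ⟨hm, hi⟩ := hv.1 l hl
      have hmn : Measurable[Mo.mHS] (fun ω => v ω (l, n)) :=
        ((measurable_pi_apply n).comp hm).mono (Mo.mS_le l) le_rfl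
      simp only [hl, if_true]
      refine ⟨hmn, hi.mono' ((hmn.mono Mo.mHS_le le_rfl).norm.pow_const 4).aestronglyMeasurable
        (ae_of_all _ fun ω => ?_)⟩
      rw [Real.norm_of_nonneg (by positivity)]
      have h2 : ‖v ω (l, n)‖ ^ 2 ≤ ∑ n, ‖v ω (l, n)‖ ^ 2 :=
        Finset.single_le_sum (f := fun n => ‖v ω (l, n)‖ ^ 2) (fun _ _ => by positivity)
          (Finset.mem_univ n)
      calc ‖v ω (l, n)‖ ^ 4 = (‖v ω (l, n)‖ ^ 2) ^ 2 := by ring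
        _ ≤ _ := by gcongr
    · simp only [hl, if_false]
      exact ⟨measurable_const, by simp⟩
  · intro l hl
    simpa only [hl, if_true] using hv.1 l hl
  · intro l hl
    simp [hl]
  · have : ∀ᵐ ω, ∀ l, l ∉ Lk → ∀ n, v ω (l, n) = 0 := by
      rw [ae_all_iff]
      intro l
      by_cases hl : l ∈ Lk
      · simp [hl]
      · simpa [hl] using hv.2 l hl
    filter_upwards [this] with ω hω
    funext ⟨l, n⟩
    by_cases hl : l ∈ Lk
    · simp [hl]
    · simp [hl, hω l hl n]

lemma smul_mem (Mo : DistUplinkModel Ω K N L 𝓢) (Lk : Finset (Fin L))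
    (v : Ω → Fin L × Fin N → ℂ) (hv : v ∈ Mo.Vset Lk) (c : ℂ) :
    (fun ω i => c * v ω i) ∈ Mo.Vset Lk := by
  refine ⟨fun l hl => ⟨?_, ?_⟩, fun l hl => ?_⟩
  · have hc : Measurable (fun (y : Fin N → ℂ) n => c * y n) := by fun_prop
    exact hc.comp (hv.1 l hl).1
  · simp_rw [norm_mul, mul_pow, ← Finset.mul_sum, mul_pow]
    exact (hv.1 l hl).2.const_mul _
  · filter_upwards [hv.2 l hl] with ω hω n
    simp [hω n]

lemma MSE_congr (Mo : DistUplinkModel Ω K N L 𝓢) {v v' : Ω → Fin L × Fin N → ℂ}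
    (h : v =ᵐ[ℙ] v') (k) : Mo.MSE k v = Mo.MSE k v' := by
  refine integral_congr_ae ?_
  filter_upwards [h] with ω hω
  rw [hω]

lemma SINR_congr (Mo : DistUplinkModel Ω K N L 𝓢) {v v' : Ω → Fin L × Fin N → ℂ}
    (h : v =ᵐ[ℙ] v') (k) : Mo.SINR_UatF k v = Mo.SINR_UatF k v' := by
  have hg : ∀ j, Mo.g j v =ᵐ[ℙ] Mo.g j v' := fun j => by
    filter_upwards [h] with ω hω
    simp only [g, hω]
  have h1 : ∫ ω, Mo.g k v ω = ∫ ω, Mo.g k v' ω := integral_congr_ae (hg k)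
  have h2 : ∀ j, ∫ ω, ‖Mo.g j v ω‖ ^ 2 = ∫ ω, ‖Mo.g j v' ω‖ ^ 2 := fun j =>
    integral_congr_ae (by filter_upwards [hg j] with ω hω; rw [hω])
  have h3 : ∫ ω, ∑ i, ‖v ω i‖ ^ 2 = ∫ ω, ∑ i, ‖v' ω i‖ ^ 2 :=
    integral_congr_ae (by filter_upwards [h] with ω hω; rw [hω])
  simp only [SINR_UatF, h1, h2, h3]

end DistUplinkModel

/-- If `vopt ∈ 𝒱_k` attains the infimum of `MSE_k` over the
information-constrained set `𝒱_k`, then `vopt` attains the supremum over `𝒱_k` of the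
use-and-then-forget ergodic rate `R_k^UatF(v) = log(1 + SINR_k^UatF(v))`. -/
theorem mse_minimizer_maximizes_uatf_rate
    {Ω : Type*} [MeasureSpace Ω] [IsProbabilityMeasure (ℙ : Measure Ω)]
    {K N L : ℕ} {𝓢 : Fin L → Type*} [∀ l, MeasurableSpace (𝓢 l)]
    (Mo : DistUplinkModel Ω K N L 𝓢) (Lk : Finset (Fin L)) (k : Fin K)
    (vopt : Ω → Fin L × Fin N → ℂ) (hvopt : vopt ∈ Mo.Vset Lk)
    (hmin : ∀ v ∈ Mo.Vset Lk, Mo.MSE k vopt ≤ Mo.MSE k v) :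
    ∀ v ∈ Mo.Vset Lk,
      Real.log (1 + Mo.SINR_UatF k v) ≤ Real.log (1 + Mo.SINR_UatF k vopt) := by
  intro v hv
  obtain ⟨u, hu, huV, hvu⟩ := Mo.exists_good Lk v hv
  obtain ⟨u', hu', -, hvu'⟩ := Mo.exists_good Lk vopt hvopt
  have key : Mo.SINR_UatF k v ≤ Mo.SINR_UatF k vopt := by
    rw [Mo.SINR_congr hvu, Mo.SINR_congr hvu', Mo.SINR_eq, Mo.SINR_eq]
    refine DistUplinkModel.ratio_core _ _ _ _ (hu.D_nonneg k) (hu.D_zero k) (hu'.D_nonneg k)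
      (hu'.D_zero k) fun c => ?_
    have h := hmin _ (Mo.smul_mem Lk u huV c)
    rw [Mo.MSE_congr hvu', hu'.MSE_eq, (hu.smul c).MSE_eq, Mo.A_smul] at h
    simp only [DistUplinkModel.g_smul, integral_const_mul] at h
    exact h
  have h0 : 0 ≤ Mo.SINR_UatF k v := by
    rw [Mo.SINR_congr hvu, Mo.SINR_eq]
    exact div_nonneg (by positivity) (hu.D_nonneg k)
  exact Real.log_le_log (by linarith) (by linarith)
end
end
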